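/- arXiv:1501.02074 — 4 statements merged into one kernel-verified Lean document; each statement's English description precedes it below -/
import Mathlib

section
/- Let E be a Banach space, T ∈ (0,∞], ζ > 1 and λ > 0, and let g : [0,∞) → [0,∞) be nondecreasing. Let a be an E-valued 2-index map on [0,T) such that M := sup { |δa_{tus}| / ( g(t/λ) (t−s)^ζ ) : 0 ≤ s ≤ u ≤ t < T, t−s ≤ λ } is finite. Then there exist a constant c_ζ, depending only on ζ, and a path A : [0,T) → E such that |A_t − A_s − a_{ts}| ≤ c_ζ g(t/λ) (t−s)^ζ M for all 0 ≤ s ≤ t < T with t−s ≤ λ. -/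
/-- The sum of the 2-index map `a` along the partition of `[0,t]` by the multiples of `δ`. -/
noncomputable def gridSum {E : Type*} [AddCommMonoid E] (a : ℝ → ℝ → E) (δ t : ℝ) : E :=
  ∑ k ∈ Finset.range ⌊t / δ⌋₊, a ((k + 1 : ℕ) * δ) (k * δ) + a t (⌊t / δ⌋₊ * δ)

/-- The increment of `a` is bounded by `K (t - s) ^ ζ` on intervals `[s,t] ⊆ [0,τ]` of length
at most `lam`. -/
def IncrementBound {E : Type*} [NormedAddCommGroup E] (a : ℝ → ℝ → E) (ζ lam K τ : ℝ) : Prop :=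
  ∀ s u t : ℝ, 0 ≤ s → s ≤ u → u ≤ t → t ≤ τ → t - s ≤ lam →
    ‖a t s - a t u - a u s‖ ≤ K * (t - s) ^ ζ

section

variable {E : Type*} [NormedAddCommGroup E] {a : ℝ → ℝ → E} {ζ lam K τ : ℝ}

lemma IncrementBound.diag (h : IncrementBound a ζ lam K τ) (hζ : 1 < ζ) (hl : 0 < lam)
    {t : ℝ} (ht : 0 ≤ t) (htτ : t ≤ τ) : a t t = 0 := by
  have := h t t t ht le_rfl le_rfl htτ (by simpa using hl.le)
  simpa [Real.zero_rpow (by linarith : ζ ≠ 0)] using this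

lemma IncrementBound.norm_le (h : IncrementBound a ζ lam K τ) (hζ : 1 < ζ) (hK : 0 ≤ K)
    {δ : ℝ} (hδl : δ ≤ lam) {s u t : ℝ} (hs : 0 ≤ s) (hsu : s ≤ u) (hut : u ≤ t)
    (ht : t ≤ τ) (hts : t - s ≤ δ) :
    ‖a t s - a t u - a u s‖ ≤ K * δ ^ ζ :=
  (h s u t hs hsu hut ht (hts.trans hδl)).trans <|
    mul_le_mul_of_nonneg_left
      (Real.rpow_le_rpow (by linarith) hts (by linarith)) hK

lemma IncrementBound.norm_gridSum_sub_le (h : IncrementBound a ζ lam K τ) (hζ : 1 < ζ)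
    (hK : 0 ≤ K) {δ : ℝ} (hδ : 0 < δ) (hδl : δ ≤ lam) {s t : ℝ} (hs : 0 ≤ s) (hst : s ≤ t)
    (ht : t ≤ τ) (hts : t - s ≤ δ) :
    ‖gridSum a δ t - gridSum a δ s - a t s‖ ≤ 2 * (K * δ ^ ζ) := by
  have hX : 0 ≤ K * δ ^ ζ := by positivity
  have hs1 : (⌊s / δ⌋₊ : ℝ) * δ ≤ s := (le_div_iff₀ hδ).1 (Nat.floor_le (by positivity))
  have hs2 : s < ((⌊s / δ⌋₊ : ℝ) + 1) * δ := (div_lt_iff₀ hδ).1 (Nat.lt_floor_add_one _)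
  have ht1 : (⌊t / δ⌋₊ : ℝ) * δ ≤ t :=
    (le_div_iff₀ hδ).1 (Nat.floor_le (div_nonneg (hs.trans hst) hδ.le))
  have ht2 : t < ((⌊t / δ⌋₊ : ℝ) + 1) * δ := (div_lt_iff₀ hδ).1 (Nat.lt_floor_add_one _)
  have hle : ⌊s / δ⌋₊ ≤ ⌊t / δ⌋₊ := Nat.floor_mono (by gcongr)
  have hlt : ⌊t / δ⌋₊ < ⌊s / δ⌋₊ + 2 := by
    have : (⌊t / δ⌋₊ : ℝ) * δ < ((⌊s / δ⌋₊ : ℝ) + 2) * δ := by linarith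
    exact_mod_cast lt_of_mul_lt_mul_right this hδ.le
  have hp : (0 : ℝ) ≤ ⌊s / δ⌋₊ * δ := by positivity
  unfold gridSum
  obtain heq | heq : ⌊t / δ⌋₊ = ⌊s / δ⌋₊ ∨ ⌊t / δ⌋₊ = ⌊s / δ⌋₊ + 1 := by omega
  · rw [heq] at ht2 ⊢
    have := h.norm_le hζ hK hδl hp hs1 hst ht (by linarith)
    rw [show ∀ S x y z : E, S + x - (S + y) - z = x - z - y by intros; abel]
    linarith
  · rw [heq, Finset.sum_range_succ]
    rw [heq] at ht1 ht2
    push_cast at ht1 ht2 ⊢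
    have h1 := h.norm_le hζ hK hδl hp hs1 hs2.le (ht1.trans ht) (by linarith)
    have h2 := h.norm_le hζ hK hδl hs hs2.le ht1 ht hts
    rw [show ∀ S x y z w v : E, S + x + y - (S + z) - w = (x - v - z) - (w - y - v) by
      intros; abel]
    exact (norm_sub_le _ _).trans (by linarith)

/-- Increments of the change under one refinement of the grid, over one grid cell. -/
lemma IncrementBound.norm_refine_sub_le_of_le (h : IncrementBound a ζ lam K τ) (hζ : 1 < ζ)
    (hK : 0 ≤ K) {δ : ℝ} (hδ : 0 < δ) (hδl : δ ≤ lam) {s t : ℝ} (hs : 0 ≤ s) (hst : s ≤ t)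
    (ht : t ≤ τ) (hts : t - s ≤ δ) :
    ‖(gridSum a (δ / 2) t - gridSum a δ t) - (gridSum a (δ / 2) s - gridSum a δ s)‖
      ≤ 7 * (K * δ ^ ζ) := by
  have hmono : K * (δ / 2) ^ ζ ≤ K * δ ^ ζ := by
    gcongr
    linarith
  have h0 := h.norm_gridSum_sub_le hζ hK hδ hδl hs hst ht hts
  have h1 := h.norm_gridSum_sub_le hζ hK (half_pos hδ) (by linarith) hs
    (t := (s + t) / 2) (by linarith) (by linarith) (by linarith)
  have h2 := h.norm_gridSum_sub_le hζ hK (half_pos hδ) (by linarith) (s := (s + t) / 2)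
    (t := t) (by linarith) (by linarith) ht (by linarith)
  have h3 := h.norm_le hζ hK hδl hs (u := (s + t) / 2) (by linarith) (by linarith) ht hts
  set v := gridSum a (δ / 2) ((s + t) / 2)
  set A := a t ((s + t) / 2)
  set B := a ((s + t) / 2) s
  rw [show (gridSum a (δ / 2) t - gridSum a δ t) - (gridSum a (δ / 2) s - gridSum a δ s)
      = (gridSum a (δ / 2) t - v - A) + (v - gridSum a (δ / 2) s - B)
        - (gridSum a δ t - gridSum a δ s - a t s) - (a t s - A - B) by abel]
  have h4 := norm_add_le (gridSum a (δ / 2) t - v - A) (v - gridSum a (δ / 2) s - B)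
  refine (norm_sub_le _ _).trans ((add_le_add_left (norm_sub_le _ _) _).trans ?_)
  linarith

lemma IncrementBound.norm_refine_sub_le (h : IncrementBound a ζ lam K τ) (hζ : 1 < ζ)
    (hK : 0 ≤ K) {δ : ℝ} (hδ : 0 < δ) (hδl : δ ≤ lam) (m : ℕ) {s t : ℝ} (hs : 0 ≤ s)
    (hst : s ≤ t) (ht : t ≤ τ) (hts : t - s ≤ m * δ) :
    ‖(gridSum a (δ / 2) t - gridSum a δ t) - (gridSum a (δ / 2) s - gridSum a δ s)‖
      ≤ m * (7 * (K * δ ^ ζ)) := by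
  induction m generalizing t with
  | zero =>
    obtain rfl : s = t := by
      push_cast at hts
      linarith
    simp
  | succ m ih =>
    push_cast at hts ⊢
    have hm : 0 ≤ m * δ := by positivity
    have h1 := ih (t := max s (t - δ)) (le_max_left _ _)
      (max_le (hst.trans ht) (by linarith)) (by
        rw [sub_le_iff_le_add]
        exact max_le (by linarith) (by linarith))
    have h2 := h.norm_refine_sub_le_of_le hζ hK hδ hδl (s := max s (t - δ)) (t := t)
      (hs.trans (le_max_left _ _)) (max_le hst (by linarith)) ht
      (by linarith [le_max_right s (t - δ)])
    refine (norm_sub_le_norm_sub_add_norm_sub _ _ _).trans ((add_le_add h2 h1).trans ?_)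
    linarith

lemma IncrementBound.dist_gridSum_succ_le (h : IncrementBound a ζ lam K τ) (hζ : 1 < ζ)
    (hK : 0 ≤ K) {δ : ℝ} (hδ : 0 < δ) (hδl : δ ≤ lam) (q : ℕ) {s t : ℝ} (hs : 0 ≤ s)
    (hst : s ≤ t) (ht : t ≤ τ) (hts : t - s ≤ q * δ) (j : ℕ) :
    dist (gridSum a (δ / 2 ^ j) t - gridSum a (δ / 2 ^ j) s)
      (gridSum a (δ / 2 ^ (j + 1)) t - gridSum a (δ / 2 ^ (j + 1)) s)
      ≤ 7 * q * (K * δ ^ ζ) * ((2 : ℝ) ^ (1 - ζ)) ^ j := by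
  have h1 : (1 : ℝ) ≤ 2 ^ j := one_le_pow₀ (by norm_num)
  have := h.norm_refine_sub_le hζ hK (δ := δ / 2 ^ j) (by positivity)
    ((div_le_self hδ.le h1).trans hδl) (q * 2 ^ j) hs hst ht (by
      push_cast
      field_simp
      linarith)
  rw [div_div, ← pow_succ] at this
  rw [dist_comm, dist_eq_norm,
    show ∀ x y z w : E, (x - y) - (z - w) = (x - z) - (y - w) by intros; abel]
  refine this.trans_eq ?_
  have h2 : ((2 : ℝ) ^ (1 - ζ)) ^ j = 2 ^ j / (2 ^ j) ^ ζ := by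
    rw [Real.rpow_sub two_pos, Real.rpow_one, div_pow, Real.rpow_pow_comm two_pos.le]
  rw [h2, Real.div_rpow hδ.le (by positivity)]
  push_cast
  ring

lemma IncrementBound.tendsto_gridSum [CompleteSpace E] (h : IncrementBound a ζ lam K τ)
    (hζ : 1 < ζ) (hK : 0 ≤ K) (hl : 0 < lam) {t : ℝ} (h0 : 0 ≤ t) (ht : t ≤ τ) :
    Filter.Tendsto (fun n : ℕ => gridSum a (lam / 2 ^ n) t) Filter.atTop
      (nhds (Filter.limUnder Filter.atTop fun n : ℕ => gridSum a (lam / 2 ^ n) t)) := by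
  have hzero : ∀ δ : ℝ, gridSum a δ 0 = 0 := fun δ => by
    simp [gridSum, h.diag hζ hl le_rfl (h0.trans ht)]
  have hr : (2 : ℝ) ^ (1 - ζ) < 1 := Real.rpow_lt_one_of_one_lt_of_neg one_lt_two (by linarith)
  have hq : t - 0 ≤ (⌈t / lam⌉₊ : ℝ) * lam := by
    rw [sub_zero]
    exact (div_le_iff₀ hl).1 (Nat.le_ceil _)
  refine CauchySeq.tendsto_limUnder (cauchySeq_of_le_geometric _ (7 * ⌈t / lam⌉₊ * (K * lam ^ ζ)) hr
    fun n => ?_)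
  simpa [hzero] using h.dist_gridSum_succ_le hζ hK hl le_rfl _ le_rfl h0 ht hq n

lemma IncrementBound.norm_limUnder_sub_le [CompleteSpace E] (h : IncrementBound a ζ lam K τ)
    (hζ : 1 < ζ) (hK : 0 ≤ K) (hl : 0 < lam) {s t : ℝ} (hs : 0 ≤ s) (hst : s ≤ t) (ht : t ≤ τ)
    (hts : t - s ≤ lam) :
    ‖Filter.limUnder Filter.atTop (fun n : ℕ => gridSum a (lam / 2 ^ n) t)
        - Filter.limUnder Filter.atTop (fun n : ℕ => gridSum a (lam / 2 ^ n) s) - a t s‖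
      ≤ (7 / (1 - 2 ^ (1 - ζ)) + 2) * 2 ^ ζ * (K * (t - s) ^ ζ) := by
  have hr : (2 : ℝ) ^ (1 - ζ) < 1 := Real.rpow_lt_one_of_one_lt_of_neg one_lt_two (by linarith)
  obtain rfl | hlt := hst.eq_or_lt
  · simp [h.diag hζ hl hs ht, Real.zero_rpow (by linarith : ζ ≠ 0)]
  have hpos : 0 < t - s := sub_pos.2 hlt
  obtain ⟨n, hn1, hn2⟩ := exists_nat_pow_near ((one_le_div hpos).2 hts) one_lt_two
  rw [le_div_iff₀ hpos] at hn1
  rw [div_lt_iff₀ hpos, pow_succ] at hn2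
  set δ := lam / 2 ^ n with hδdef
  have hδ : 0 < δ := by positivity
  have hδl : δ ≤ lam := div_le_self hl.le (one_le_pow₀ (by norm_num))
  have htsδ : t - s ≤ δ := (le_div_iff₀ (by positivity)).2 (by linarith)
  have hδts : δ ≤ 2 * (t - s) := (div_le_iff₀ (by positivity)).2 (by linarith)
  have hlim := ((h.tendsto_gridSum hζ hK hl (hs.trans hst) ht).sub
    (h.tendsto_gridSum hζ hK hl hs (hst.trans ht))).comp (Filter.tendsto_add_atTop_nat n)
  have hshift : ∀ j : ℕ, lam / 2 ^ (j + n) = δ / 2 ^ j := fun j => by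
    rw [hδdef, div_div, ← pow_add, add_comm]
  simp only [Function.comp_def, hshift] at hlim
  have h1 := dist_le_of_le_geometric_of_tendsto₀ _ _ hr
    (h.dist_gridSum_succ_le hζ hK hδ hδl 1 hs hst ht (by simpa using htsδ)) hlim
  have h2 := h.norm_gridSum_sub_le hζ hK hδ hδl hs hst ht htsδ
  rw [dist_comm, dist_eq_norm, pow_zero, div_one] at h1
  have h3 : K * δ ^ ζ ≤ 2 ^ ζ * (K * (t - s) ^ ζ) := by
    have := Real.rpow_le_rpow hδ.le hδts (by linarith : 0 ≤ ζ)
    rw [Real.mul_rpow two_pos.le hpos.le] at this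
    nlinarith
  have hc : 0 ≤ 7 / (1 - (2 : ℝ) ^ (1 - ζ)) + 2 := by
    have := sub_pos.2 hr
    positivity
  rw [← sub_add_sub_cancel _ (gridSum a δ t - gridSum a δ s), mul_assoc]
  refine (norm_add_le _ _).trans ((add_le_add h1 h2).trans
    (le_trans (le_of_eq ?_) (mul_le_mul_of_nonneg_left h3 hc)))
  push_cast
  ring

end

theorem weighted_sewing_lemma (ζ : ℝ) (hζ : 1 < ζ) :
    ∃ c : ℝ, 0 < c ∧
      ∀ (E : Type) [NormedAddCommGroup E] [NormedSpace ℝ E] [CompleteSpace E]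
        (T : EReal), 0 < T →
      ∀ (lam : ℝ), 0 < lam →
      ∀ (g : ℝ → ℝ), (∀ t : ℝ, 0 ≤ t → 0 ≤ g t) →
        (∀ s t : ℝ, 0 ≤ s → s ≤ t → g s ≤ g t) →
      ∀ (a : ℝ → ℝ → E) (M : ℝ),
        (∀ s u t : ℝ, 0 ≤ s → s ≤ u → u ≤ t → (t : EReal) < T → t - s ≤ lam →
          ‖a t s - a t u - a u s‖ ≤ M * (g (t / lam) * (t - s) ^ ζ)) →
        ∃ A : ℝ → E, ∀ s t : ℝ, 0 ≤ s → s ≤ t → (t : EReal) < T → t - s ≤ lam →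
          ‖A t - A s - a t s‖ ≤ c * g (t / lam) * (t - s) ^ ζ * M := by
  have hr : (2 : ℝ) ^ (1 - ζ) < 1 := Real.rpow_lt_one_of_one_lt_of_neg one_lt_two (by linarith)
  have hr' := sub_pos.2 hr
  refine ⟨(7 / (1 - 2 ^ (1 - ζ)) + 2) * 2 ^ ζ, by positivity, ?_⟩
  intro E _ _ _ T _ lam hl g hg0 hgm a M h
  refine ⟨fun t => Filter.limUnder Filter.atTop (fun n : ℕ => gridSum a (lam / 2 ^ n) t),
    fun s t hs hst htT hts => ?_⟩
  have ht := hs.trans hst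
  have hbound : IncrementBound a ζ lam (max M 0 * g (t / lam)) t := by
    intro s' u' t' hs' hsu' hut' htt' hts'
    have hx : 0 ≤ (t' - s') ^ ζ := Real.rpow_nonneg (by linarith) _
    have h0 : 0 ≤ t' / lam := div_nonneg (by linarith) hl.le
    refine (h s' u' t' hs' hsu' hut'
      ((EReal.coe_le_coe_iff.2 htt').trans_lt htT) hts').trans ?_
    rw [mul_assoc]
    exact mul_le_mul (le_max_left _ _)
      (mul_le_mul_of_nonneg_right (hgm _ _ h0 (by gcongr)) hx)
      (mul_nonneg (hg0 _ h0) hx) (le_max_right _ _)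
  have hgt := hg0 _ (div_nonneg ht hl.le)
  refine (hbound.norm_limUnder_sub_le hζ (mul_nonneg (le_max_right _ _) hgt) hl hs hst le_rfl
    hts).trans_eq ?_
  have hnn := (norm_nonneg _).trans (h s s t hs le_rfl hst htT hts)
  have hw : 0 ≤ g (t / lam) * (t - s) ^ ζ :=
    mul_nonneg hgt (Real.rpow_nonneg (by linarith) _)
  have hM : max M 0 * (g (t / lam) * (t - s) ^ ζ) = M * (g (t / lam) * (t - s) ^ ζ) := by
    rw [max_mul_of_nonneg _ _ hw, zero_mul, max_eq_left hnn]
  rw [mul_assoc (max M 0), hM]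
  ring
end

section
/- Let E be a Banach space, 0 < γ ≤ 1 and λ > 0, and let f : [0,∞) → E be a path such that ⦇δf⦈_γ := sup { e^{−t/λ} |f_t − f_s| / (t−s)^γ : 0 ≤ s < t, t−s ≤ λ } is finite. Then sup_{t ≥ 0} e^{−t/λ} |f_t| ≤ |f_0| + e λ^γ ⦇δf⦈_γ. -/
/-!
STATEMENT 1.
For a path `f : [0,∞) → E` in a Banach space, with `δf t s := f t - f s`, if
`D` is (an upper bound for) `⦇δf⦈_γ := sup { e^{-t/λ} ‖f t - f s‖ / (t-s)^γ :
0 ≤ s < t, t - s ≤ λ }`, then `sup_{t ≥ 0} e^{-t/λ} ‖f t‖ ≤ ‖f 0‖ + e λ^γ D`.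
-/
theorem weighted_path_bound
    (E : Type) [NormedAddCommGroup E] [NormedSpace ℝ E] [CompleteSpace E]
    (γ : ℝ) (hγ0 : 0 < γ) (hγ1 : γ ≤ 1) (lam : ℝ) (hlam : 0 < lam)
    (f : ℝ → E) (D : ℝ)
    (hD : ∀ s t : ℝ, 0 ≤ s → s < t → t - s ≤ lam →
      Real.exp (-(t / lam)) * ‖f t - f s‖ / (t - s) ^ γ ≤ D) :
    ∀ t : ℝ, 0 ≤ t →
      Real.exp (-(t / lam)) * ‖f t‖ ≤ ‖f 0‖ + Real.exp 1 * lam ^ γ * D := by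
  have hD0 : 0 ≤ D := by
    refine le_trans ?_ (hD 0 lam le_rfl hlam (by simp))
    rw [sub_zero]
    positivity
  have hL : 0 ≤ lam ^ γ * D := by positivity
  have he : 2 ≤ Real.exp 1 := by linarith [Real.add_one_le_exp (1 : ℝ)]
  have increment : ∀ s t : ℝ, 0 ≤ s → s < t → t - s ≤ lam →
      Real.exp (-(t / lam)) * ‖f t‖ ≤ Real.exp (-(t / lam)) * ‖f s‖ + lam ^ γ * D := by
    intro s t hs hst hts
    have hpos : 0 < t - s := sub_pos.2 hst
    have h1 := (div_le_iff₀ (Real.rpow_pos_of_pos hpos γ)).1 (hD s t hs hst hts)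
    have h2 : D * (t - s) ^ γ ≤ D * lam ^ γ := by gcongr
    have h3 : ‖f t‖ ≤ ‖f s‖ + ‖f t - f s‖ := norm_le_norm_add_norm_sub' _ _
    have h4 := mul_le_mul_of_nonneg_left h3 (Real.exp_pos (-(t / lam))).le
    linarith
  have exp_le : ∀ t : ℝ, 0 ≤ t → Real.exp (-(t / lam)) ≤ 1 := fun t ht =>
    Real.exp_le_one_iff.2 (neg_nonpos.2 (by positivity))
  have bound_upto : ∀ n : ℕ, ∀ t : ℝ, 0 ≤ t → t ≤ n * lam →
      Real.exp (-(t / lam)) * ‖f t‖ ≤ ‖f 0‖ + Real.exp 1 * lam ^ γ * D := by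
    intro n
    induction n with
    | zero =>
      intro t ht htn
      obtain rfl : t = 0 := le_antisymm (by simpa using htn) ht
      simp only [zero_div, neg_zero, Real.exp_zero, one_mul]
      exact le_add_of_nonneg_right (by positivity)
    | succ n ih =>
      intro t ht htn
      rcases ht.eq_or_lt with rfl | ht0
      · exact ih 0 le_rfl (by positivity)
      rcases le_or_gt t lam with htl | htl
      · have h1 := increment 0 t le_rfl ht0 (by simpa using htl)
        have h2 := mul_le_of_le_one_left (norm_nonneg (f 0)) (exp_le t ht)
        nlinarith
      · have h1 := increment (t - lam) t (by linarith) (by linarith) (by simp)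
        have h2 := ih (t - lam) (by linarith) (by push_cast at htn; linarith)
        have h3 : Real.exp (-(t / lam)) = Real.exp (-1) * Real.exp (-((t - lam) / lam)) := by
          rw [← Real.exp_add]
          congr 1
          field_simp
          ring
        have h4 : Real.exp (-1) * Real.exp 1 = 1 := by rw [← Real.exp_add]; simp
        have h5 : Real.exp (-1) ≤ 1 := Real.exp_le_one_iff.2 (by norm_num)
        calc Real.exp (-(t / lam)) * ‖f t‖
            ≤ Real.exp (-1) * (Real.exp (-((t - lam) / lam)) * ‖f (t - lam)‖)
                + lam ^ γ * D := by rw [← mul_assoc, ← h3]; exact h1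
          _ ≤ Real.exp (-1) * (‖f 0‖ + Real.exp 1 * lam ^ γ * D) + lam ^ γ * D := by gcongr
          _ = Real.exp (-1) * ‖f 0‖ + 2 * (lam ^ γ * D) := by
            linear_combination (lam ^ γ * D) * h4
          _ ≤ 1 * ‖f 0‖ + Real.exp 1 * (lam ^ γ * D) := by gcongr
          _ = ‖f 0‖ + Real.exp 1 * lam ^ γ * D := by ring
  intro t ht
  obtain ⟨n, hn⟩ := exists_nat_ge (t / lam)
  exact bound_upto n t ht ((div_le_iff₀ hlam).1 hn)
end

section
/- Let 1/3 < γ ≤ 1/2, let 𝒜 be a Banach algebra with unit, let T ∈ (0,∞], and let 𝐀 = (A¹,A²) be a bounded γ-rough driver in 𝒜 on [0,T). Then for every f₀ ∈ 𝒜 there exists exactly one path f : [0,T) → 𝒜 with f(0) = f₀ which is γ-Hölder on bounded intervals and such that the 2-index map f♯_{ts} := f_t − f_s − (A¹_{ts} + A²_{ts}) f_s satisfies sup { |f♯_{ts}| / (t−s)^{3γ} : 0 ≤ s < t ≤ S, t−s ≤ 1 } < ∞ for every S < T. -/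
/-!
STATEMENT 2 (integration of bounded rough drivers).
A bounded γ-rough driver in a Banach algebra `𝒜` on `[0,T)` (`T ∈ (0,∞]`,
modelled as `T : EReal`) is a pair of 2-index maps `A1 A2 : ℝ → ℝ → 𝒜`
(value at `0 ≤ s ≤ t < T` written `A t s`) satisfying Chen's relations and
having finite norm `‖𝐀‖`.  A path `f` starting at `f₀` solves the linear rough
equation if it is γ-Hölder on bounded intervals and the remainder
`f♯ t s := f t - f s - (A1 t s + A2 t s) * f s` is locally 3γ-Hölder.
-/

/-- Chen's relations for a pair of 2-index maps on `[0,T)`. -/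
def ChenRelations {A : Type} [NormedRing A] (T : EReal)
    (A1 A2 : ℝ → ℝ → A) : Prop :=
  ∀ s u t : ℝ, 0 ≤ s → s ≤ u → u ≤ t → (t : EReal) < T →
    A1 t s = A1 t u + A1 u s ∧
    A2 t s = A2 t u + A2 u s + A1 t u * A1 u s

/-- `K` is an upper bound for the rough-driver norm
`‖𝐀‖ = sup { max (‖A1 t s‖/(t-s)^γ) (‖A2 t s‖/(t-s)^{2γ}) : 0 ≤ s < t < T, t-s ≤ 1 }`. -/
def DriverNormBound {A : Type} [NormedRing A] (γ : ℝ) (T : EReal)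
    (A1 A2 : ℝ → ℝ → A) (K : ℝ) : Prop :=
  ∀ s t : ℝ, 0 ≤ s → s ≤ t → (t : EReal) < T → t - s ≤ 1 →
    ‖A1 t s‖ ≤ K * (t - s) ^ γ ∧ ‖A2 t s‖ ≤ K * (t - s) ^ (2 * γ)

/-- A 2-index map `b` on `[0,T)` is locally `β`-Hölder:
`sup { ‖b t s‖/(t-s)^β : 0 ≤ s < t ≤ S, t-s ≤ 1 } < ∞` for every `S < T`. -/
def LocallyHolder {E : Type} [NormedAddCommGroup E] (β : ℝ) (T : EReal)
    (b : ℝ → ℝ → E) : Prop :=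
  ∀ S : ℝ, (S : EReal) < T → ∃ C : ℝ, ∀ s t : ℝ,
    0 ≤ s → s ≤ t → t ≤ S → t - s ≤ 1 → ‖b t s‖ ≤ C * (t - s) ^ β

/-- `f` solves the linear rough equation `df = 𝐀(dt) f` on `[0,T)`:
it is γ-Hölder on bounded intervals and the remainder
`f♯ t s := f t - f s - (A1 t s + A2 t s) f s` is locally 3γ-Hölder. -/
def IsRoughLinearSolution {A : Type} [NormedRing A] (γ : ℝ) (T : EReal)
    (A1 A2 : ℝ → ℝ → A) (f : ℝ → A) : Prop :=
  LocallyHolder γ T (fun t s => f t - f s) ∧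
  LocallyHolder (3 * γ) T (fun t s => f t - f s - (A1 t s + A2 t s) * f s)

open Filter Topology

/-- A two-index map `μ` on `I` with values in a normed ring which is close to `1` and multiplicative
up to an error `c * (t - s) ^ p` on intervals of length at most `δ`; the constants `η` and `L` are
such that products of `μ` along partitions stay within `L * (t - s) ^ p` of `μ`. -/
structure IsAlmostFlow {A : Type*} [NormedRing A] (I : Set ℝ) (p δ η c L : ℝ)
    (μ : ℝ → ℝ → A) : Prop where
  ordConnected : I.OrdConnected
  one_lt : 1 < p
  delta_pos : 0 < δ
  eta_nonneg : 0 ≤ η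
  eta_le : η ≤ 1
  c_nonneg : 0 ≤ c
  L_nonneg : 0 ≤ L
  L_mul_le : L * δ ^ p ≤ η
  closing : 2 * (1 / 2 : ℝ) ^ p * (1 + 2 * η) ^ 2 * L + 3 * c ≤ L
  self : ∀ s ∈ I, μ s s = 1
  near_one : ∀ s ∈ I, ∀ t ∈ I, s ≤ t → t - s ≤ δ → ‖μ t s - 1‖ ≤ η
  defect : ∀ s ∈ I, ∀ t ∈ I, ∀ u, s ≤ u → u ≤ t → t - s ≤ δ →
    ‖μ t u * μ u s - μ t s‖ ≤ c * (t - s) ^ p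

/-- `P` is the product of `μ` along the points of `D`. -/
structure IsPartitionProduct {A : Type*} [NormedRing A] (I : Set ℝ) (μ : ℝ → ℝ → A)
    (D : Finset ℝ) (P : ℝ → ℝ → A) : Prop where
  eq_of_forall_notMem : ∀ s ∈ I, ∀ t ∈ I, s ≤ t → (∀ x ∈ D, ¬(s < x ∧ x < t)) → P t s = μ t s
  mul : ∀ s ∈ I, ∀ t ∈ I, ∀ u ∈ D, s ≤ u → u ≤ t → P t s = P t u * P u s

section NormedRing

variable {A : Type*} [NormedRing A]

theorem norm_mul_le_of_norm_sub_one_le_right {x y : A} {e : ℝ} (h : ‖y - 1‖ ≤ e) :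
    ‖x * y‖ ≤ ‖x‖ * (1 + e) := by
  have : x * y = x + x * (y - 1) := by noncomm_ring
  rw [this]
  calc ‖x + x * (y - 1)‖ ≤ ‖x‖ + ‖x‖ * ‖y - 1‖ :=
        (norm_add_le _ _).trans (by gcongr; exact norm_mul_le _ _)
    _ ≤ ‖x‖ + ‖x‖ * e := by gcongr
    _ = _ := by ring

theorem norm_mul_le_of_norm_sub_one_le_left {x y : A} {e : ℝ} (h : ‖x - 1‖ ≤ e) :
    ‖x * y‖ ≤ (1 + e) * ‖y‖ := by
  have : x * y = y + (x - 1) * y := by noncomm_ring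
  rw [this]
  calc ‖y + (x - 1) * y‖ ≤ ‖y‖ + ‖x - 1‖ * ‖y‖ :=
        (norm_add_le _ _).trans (by gcongr; exact norm_mul_le _ _)
    _ ≤ ‖y‖ + e * ‖y‖ := by gcongr
    _ = _ := by ring

theorem exists_isPartitionProduct {I : Set ℝ} (hI : I.OrdConnected) {μ : ℝ → ℝ → A}
    (hμ : ∀ s ∈ I, μ s s = 1) (D : Finset ℝ) : ∃ P, IsPartitionProduct I μ D P := by
  induction D using Finset.induction with
  | empty => exact ⟨μ, fun _ _ _ _ _ _ => rfl, by simp⟩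
  | insert x D hx ih =>
    obtain ⟨P, h0, h1⟩ := ih
    have hs : ∀ s ∈ I, P s s = 1 := fun s h => by
      rw [h0 s h s h le_rfl (fun y _ hy => absurd (hy.1.trans hy.2) (lt_irrefl _)), hμ s h]
    refine ⟨fun t s => if s < x ∧ x < t then P t x * P x s else P t s, ?_, ?_⟩
    · intro s hsI t htI hst hD
      rw [if_neg (hD x (Finset.mem_insert_self _ _))]
      exact h0 s hsI t htI hst fun y hy => hD y (Finset.mem_insert_of_mem hy)
    · intro s hsI t htI u hu hsu hut
      have huI : u ∈ I := hI.out hsI htI ⟨hsu, hut⟩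
      rcases Finset.mem_insert.1 hu with rfl | huD
      · rcases hsu.eq_or_lt with rfl | hsu
        · simp [hs s hsI]
        · rcases hut.eq_or_lt with rfl | hut
          · simp [hs u huI]
          · simp [hsu, hut]
      · by_cases hsx : s < x ∧ x < t
        · have hxI : x ∈ I := hI.out hsI htI ⟨hsx.1.le, hsx.2.le⟩
          rw [if_pos hsx]
          rcases lt_trichotomy x u with hxu | rfl | hxu
          · rw [if_neg (fun h => absurd h.1 hxu.not_gt), if_pos ⟨hsx.1, hxu⟩,
              h1 x hxI t htI u huD hxu.le hut, mul_assoc]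
          · simp
          · rw [if_pos ⟨hxu, hsx.2⟩, if_neg (fun h => absurd h.2 hxu.not_gt),
              h1 s hsI x hxI u huD hsu hxu.le, mul_assoc]
        · rw [if_neg hsx, if_neg (fun h => hsx ⟨hsu.trans_lt h.1, h.2⟩),
            if_neg (fun h => hsx ⟨h.1, h.2.trans_le hut⟩)]
          exact h1 s hsI t htI u huD hsu hut

/-- The endpoints of the division of `[s, t]` into `N` intervals of equal length. -/
noncomputable def uniformPartition (s t : ℝ) (N : ℕ) : Finset ℝ :=
  (Finset.range (N + 1)).image fun k : ℕ => s + k * ((t - s) / N)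

theorem norm_sub_le_of_uniformPartition {Q : ℝ → ℝ → A} {y : ℝ → A} {s t B b : ℝ} {N : ℕ}
    (hst : s ≤ t) (hN : 0 < N) (hB : 0 ≤ B)
    (H : ∀ u ∈ uniformPartition s t N, ∀ v ∈ uniformPartition s t N, s ≤ u → u ≤ v → v ≤ t →
      v - u = (t - s) / N → Q t u = Q t v * Q v u ∧ ‖Q t v‖ ≤ B ∧ ‖y v - Q v u * y u‖ ≤ b) :
    ‖Q t t * y t - Q t s * y s‖ ≤ N * (B * b) := by
  have hN' : (0 : ℝ) < N := by exact_mod_cast hN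
  have hq : 0 ≤ (t - s) / N := div_nonneg (by linarith) hN'.le
  have hend : s + N * ((t - s) / N) = t := by field_simp; ring
  have h := dist_le_range_sum_of_dist_le
    (f := fun k : ℕ => Q t (s + k * ((t - s) / N)) * y (s + k * ((t - s) / N))) N
    (d := fun _ => B * b) (by
    intro k hk
    have hmem : ∀ j ≤ N, s + (j : ℝ) * ((t - s) / N) ∈ uniformPartition s t N := fun j hj =>
      Finset.mem_image.2 ⟨j, Finset.mem_range.2 (by omega), rfl⟩
    have hlow : s ≤ s + (k : ℝ) * ((t - s) / N) := by
      have := mul_nonneg k.cast_nonneg hq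
      linarith
    have hstep : s + ((k + 1 : ℕ) : ℝ) * ((t - s) / N) - (s + (k : ℝ) * ((t - s) / N)) =
      (t - s) / N := by push_cast; ring
    have hup : s + ((k + 1 : ℕ) : ℝ) * ((t - s) / N) ≤ t := by
      have h1 : ((k + 1 : ℕ) : ℝ) ≤ N := by exact_mod_cast hk
      have h2 := mul_le_mul_of_nonneg_right h1 hq
      linarith
    obtain ⟨h1, h2, h3⟩ := H _ (hmem k hk.le) _ (hmem (k + 1) hk) hlow (by linarith) hup hstep
    rw [dist_comm, dist_eq_norm, h1, mul_assoc, ← mul_sub]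
    exact (norm_mul_le _ _).trans (mul_le_mul h2 h3 (norm_nonneg _) hB))
  rw [dist_comm, dist_eq_norm] at h
  simpa [hend] using h

theorem tendsto_nat_mul_div_rpow {p : ℝ} (hp : 1 < p) (B c : ℝ) {d : ℝ} (hd : 0 ≤ d) :
    Tendsto (fun N : ℕ => (N : ℝ) * (B * (c * (d / N) ^ p))) atTop (𝓝 0) := by
  have h := ((tendsto_rpow_neg_atTop (sub_pos.2 hp)).comp
    tendsto_natCast_atTop_atTop).const_mul (B * (c * d ^ p))
  rw [mul_zero] at h
  refine h.congr' ?_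
  filter_upwards [eventually_gt_atTop 0] with N hN
  have hN' : (0 : ℝ) < N := by exact_mod_cast hN
  simp only [Function.comp]
  rw [Real.div_rpow hd hN'.le, neg_sub, Real.rpow_sub hN', Real.rpow_one]
  field_simp

namespace IsAlmostFlow

variable {I : Set ℝ} {p δ η c L : ℝ} {μ : ℝ → ℝ → A} {D : Finset ℝ} {P : ℝ → ℝ → A}

theorem partitionProduct_self (h : IsAlmostFlow I p δ η c L μ) (hP : IsPartitionProduct I μ D P)
    {s : ℝ} (hs : s ∈ I) : P s s = 1 := by
  rw [hP.eq_of_forall_notMem s hs s hs le_rfl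
    (fun y _ hy => absurd (hy.1.trans hy.2) (lt_irrefl _)), h.self s hs]

theorem L_mul_rpow_le (h : IsAlmostFlow I p δ η c L μ) {s t : ℝ} (hst : s ≤ t) (hd : t - s ≤ δ) :
    L * (t - s) ^ p ≤ η := by
  have := h.one_lt
  have := h.L_nonneg
  refine le_trans ?_ h.L_mul_le
  gcongr

theorem norm_sub_one_le_of_norm_sub_le (h : IsAlmostFlow I p δ η c L μ) {s t : ℝ} (hs : s ∈ I)
    (ht : t ∈ I) (hst : s ≤ t) (hd : t - s ≤ δ) {x : A} (hx : ‖x - μ t s‖ ≤ L * (t - s) ^ p) :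
    ‖x - 1‖ ≤ 2 * η := by
  have h1 := h.near_one s hs t ht hst hd
  have h2 := norm_sub_le_norm_sub_add_norm_sub x (μ t s) 1
  have h3 := h.L_mul_rpow_le hst hd
  linarith

theorem norm_le_of_norm_sub_le (h : IsAlmostFlow I p δ η c L μ) {s t : ℝ} (hs : s ∈ I)
    (ht : t ∈ I) (hst : s ≤ t) (hd : t - s ≤ δ) {x : A} (hx : ‖x - μ t s‖ ≤ L * (t - s) ^ p) :
    ‖x‖ ≤ ‖(1 : A)‖ + 2 * η := by
  have h1 := h.norm_sub_one_le_of_norm_sub_le hs ht hst hd hx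
  have h2 := norm_le_norm_add_norm_sub (1 : A) x
  rw [norm_sub_rev] at h1
  linarith

/-- Bisection step of the bound on partition products. -/
theorem norm_mul_mul_sub_le (h : IsAlmostFlow I p δ η c L μ) {s u v t : ℝ} (hs : s ∈ I)
    (ht : t ∈ I) (hsu : s ≤ u) (hum : u ≤ (s + t) / 2) (hmv : (s + t) / 2 ≤ v) (hvt : v ≤ t)
    (hd : t - s ≤ δ) {x y : A} (hx : ‖x - μ u s‖ ≤ L * (u - s) ^ p)
    (hy : ‖y - μ t v‖ ≤ L * (t - v) ^ p) :
    ‖y * (μ v u * x) - μ t s‖ ≤ L * (t - s) ^ p := by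
  have hp := h.one_lt
  have hη := h.eta_nonneg
  have hη1 := h.eta_le
  have hc := h.c_nonneg
  have hL := h.L_nonneg
  have hst : s ≤ t := by linarith
  have hu : u ∈ I := h.ordConnected.out hs ht ⟨hsu, by linarith⟩
  have hv : v ∈ I := h.ordConnected.out hs ht ⟨by linarith, hvt⟩
  have hx1 : ‖x - 1‖ ≤ 2 * η :=
    h.norm_sub_one_le_of_norm_sub_le hs hu hsu (by linarith) hx
  have hvu : ‖μ v u - 1‖ ≤ 2 * η :=
    (h.near_one u hu v hv (by linarith) (by linarith)).trans (by linarith)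
  have htv : ‖μ t v - 1‖ ≤ η := h.near_one v hv t ht hvt (by linarith)
  have htv' : ‖μ t v - 1‖ ≤ 2 * η := htv.trans (by linarith)
  have half : ((t - s) / 2) ^ p = (1 / 2 : ℝ) ^ p * (t - s) ^ p := by
    rw [← Real.mul_rpow (by norm_num) (by linarith)]; congr 1; ring
  set W := (t - s) ^ p with hW
  have hW0 : 0 ≤ W := Real.rpow_nonneg (by linarith) _
  have hx2 : ‖x - μ u s‖ ≤ L * ((1 / 2 : ℝ) ^ p * W) := by
    refine hx.trans ?_
    rw [← half]
    gcongr
    linarith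
  have hy2 : ‖y - μ t v‖ ≤ L * ((1 / 2 : ℝ) ^ p * W) := by
    refine hy.trans ?_
    rw [← half]
    gcongr
    linarith
  have e1 : ‖(y - μ t v) * μ v u * x‖ ≤ L * ((1 / 2 : ℝ) ^ p * W) * (1 + 2 * η) * (1 + 2 * η) := by
    refine (norm_mul_le_of_norm_sub_one_le_right hx1).trans ?_
    gcongr
    refine (norm_mul_le_of_norm_sub_one_le_right hvu).trans ?_
    gcongr
  have e2 : ‖μ t v * (μ v u * (x - μ u s))‖ ≤
      (1 + 2 * η) * ((1 + 2 * η) * (L * ((1 / 2 : ℝ) ^ p * W))) := by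
    refine (norm_mul_le_of_norm_sub_one_le_left htv').trans ?_
    gcongr
    refine (norm_mul_le_of_norm_sub_one_le_left hvu).trans ?_
    gcongr
  have e3 : ‖μ t v * (μ v u * μ u s - μ v s)‖ ≤ (1 + η) * (c * W) := by
    refine (norm_mul_le_of_norm_sub_one_le_left htv).trans ?_
    gcongr
    refine (h.defect s hs v hv u hsu (by linarith) (by linarith)).trans ?_
    rw [hW]
    gcongr
    linarith
  have e4 : ‖μ t v * μ v s - μ t s‖ ≤ c * W := h.defect s hs t ht v (by linarith) hvt hd
  have key : y * (μ v u * x) - μ t s = (y - μ t v) * μ v u * x + μ t v * (μ v u * (x - μ u s)) +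
      μ t v * (μ v u * μ u s - μ v s) + (μ t v * μ v s - μ t s) := by noncomm_ring
  rw [key]
  have e5 := norm_add₄_le (a := (y - μ t v) * μ v u * x) (b := μ t v * (μ v u * (x - μ u s)))
    (c := μ t v * (μ v u * μ u s - μ v s)) (d := μ t v * μ v s - μ t s)
  have e6 := mul_le_mul_of_nonneg_right h.closing hW0
  have e7 : (1 + η) * (c * W) ≤ 2 * (c * W) := by gcongr; linarith
  linarith

theorem norm_partitionProduct_sub_le (h : IsAlmostFlow I p δ η c L μ)
    (hP : IsPartitionProduct I μ D P) {s t : ℝ} (hs : s ∈ I) (ht : t ∈ I) (hst : s ≤ t)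
    (hd : t - s ≤ δ) : ‖P t s - μ t s‖ ≤ L * (t - s) ^ p := by
  induction hn : (D.filter fun x => s < x ∧ x < t).card using Nat.strong_induction_on
    generalizing s t with
  | _ n ih =>
  have triv : ∀ r ∈ I, ‖P r r - μ r r‖ ≤ L * (r - r) ^ p := fun r hr => by
    rw [h.partitionProduct_self hP hr, h.self r hr, sub_self, norm_zero, sub_self]
    exact mul_nonneg h.L_nonneg (Real.rpow_nonneg le_rfl _)
  rcases hst.eq_or_lt with rfl | hlt
  · exact triv s hs
  obtain ⟨u, hu, humax⟩ := Finset.exists_max_image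
    (insert s (D.filter fun x => s ≤ x ∧ x ≤ (s + t) / 2)) id ⟨s, Finset.mem_insert_self _ _⟩
  obtain ⟨v, hv, hvmin⟩ := Finset.exists_min_image
    (insert t (D.filter fun x => (s + t) / 2 ≤ x ∧ x ≤ t)) id ⟨t, Finset.mem_insert_self _ _⟩
  simp only [Finset.mem_insert, Finset.mem_filter, id] at hu hv humax hvmin
  have hsu : s ≤ u := humax s (Or.inl rfl)
  have hvt : v ≤ t := hvmin t (Or.inl rfl)
  have hum : u ≤ (s + t) / 2 := by rcases hu with rfl | hu <;> [linarith; exact hu.2.2]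
  have hmv : (s + t) / 2 ≤ v := by rcases hv with rfl | hv <;> [linarith; exact hv.2.1]
  have huI : u ∈ I := h.ordConnected.out hs ht ⟨hsu, by linarith⟩
  have hvI : v ∈ I := h.ordConnected.out hs ht ⟨by linarith, hvt⟩
  have huv : P v u = μ v u := by
    refine hP.eq_of_forall_notMem u huI v hvI (by linarith) fun x hx hxuv => ?_
    rcases le_total x ((s + t) / 2) with hxm | hxm
    · exact absurd (humax x (Or.inr ⟨hx, by linarith, hxm⟩)) hxuv.1.not_ge
    · exact absurd (hvmin x (Or.inr ⟨hx, hxm, by linarith⟩)) hxuv.2.not_ge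
  have split₁ : P t s = P t v * P v s := by
    rcases hv with rfl | hv
    · rw [h.partitionProduct_self hP ht, one_mul]
    · exact hP.mul s hs t ht v hv.1 (by linarith) hvt
  have split₂ : P v s = P v u * P u s := by
    rcases hu with rfl | hu
    · rw [h.partitionProduct_self hP hs, mul_one]
    · exact hP.mul s hs v hvI u hu.1 hsu (by linarith)
  rw [split₁, split₂, huv]
  refine h.norm_mul_mul_sub_le hs ht hsu hum hmv hvt hd ?_ ?_
  · rcases hsu.eq_or_lt with rfl | hsu'
    · exact triv _ hs
    · refine ih _ ?_ hs huI hsu (by linarith) rfl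
      rw [← hn]
      have huD : u ∈ D := by rcases hu with rfl | hu <;> [exact absurd hsu' (lt_irrefl _); exact hu.1]
      refine Finset.card_lt_card (Finset.ssubset_iff_of_subset ?_ |>.2 ⟨u, ?_, ?_⟩)
      · intro x hx
        simp only [Finset.mem_filter] at hx ⊢
        exact ⟨hx.1, hx.2.1, by linarith⟩
      · simp only [Finset.mem_filter]
        exact ⟨huD, hsu', by linarith⟩
      · simp
  · rcases hvt.eq_or_lt with rfl | hvt'
    · exact triv _ ht
    · refine ih _ ?_ hvI ht hvt (by linarith) rfl
      rw [← hn]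
      have hvD : v ∈ D := by rcases hv with rfl | hv <;> [exact absurd hvt' (lt_irrefl _); exact hv.1]
      refine Finset.card_lt_card (Finset.ssubset_iff_of_subset ?_ |>.2 ⟨v, ?_, ?_⟩)
      · intro x hx
        simp only [Finset.mem_filter] at hx ⊢
        exact ⟨hx.1, by linarith, hx.2.2⟩
      · simp only [Finset.mem_filter]
        exact ⟨hvD, by linarith, hvt'⟩
      · simp

/-- A path which is locally propagated by `M` up to an error of order `p > 1` is propagated by `M`. -/
theorem eq_mul_of_norm_sub_le (h : IsAlmostFlow I p δ η c L μ) {M : ℝ → ℝ → A}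
    (hM : ∀ s ∈ I, ∀ t ∈ I, ∀ u, s ≤ u → u ≤ t → M t s = M t u * M u s)
    (hM1 : ∀ s ∈ I, M s s = 1)
    (hMμ : ∀ s ∈ I, ∀ t ∈ I, s ≤ t → t - s ≤ δ → ‖M t s - μ t s‖ ≤ L * (t - s) ^ p)
    {s t C : ℝ} (hs : s ∈ I) (ht : t ∈ I) (hst : s ≤ t) (hd : t - s ≤ δ) {g : ℝ → A}
    (hg : ∀ u v, s ≤ u → u ≤ v → v ≤ t → ‖g v - M v u * g u‖ ≤ C * (v - u) ^ p) :
    g t = M t s * g s := by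
  have key : ∀ᶠ N : ℕ in atTop, ‖g t - M t s * g s‖ ≤
      N * ((‖(1 : A)‖ + 2 * η) * (C * ((t - s) / N) ^ p)) := by
    filter_upwards [eventually_gt_atTop 0] with N hN
    have := norm_sub_le_of_uniformPartition (Q := M) (y := g) (s := s) (t := t)
      (B := ‖(1 : A)‖ + 2 * η) (b := C * ((t - s) / N) ^ p) hst hN
      (add_nonneg (norm_nonneg _) (by linarith [h.eta_nonneg]))
      (fun u _ v _ hsu huv hvt hvu => by
        have hu := h.ordConnected.out hs ht ⟨hsu, huv.trans hvt⟩
        have hv := h.ordConnected.out hs ht ⟨hsu.trans huv, hvt⟩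
        refine ⟨hM u hu t ht v huv hvt, h.norm_le_of_norm_sub_le hv ht hvt (by linarith)
          (hMμ v hv t ht hvt (by linarith)), ?_⟩
        rw [← hvu]
        exact hg u v hsu huv hvt)
    rwa [hM1 t ht, one_mul] at this
  have := ge_of_tendsto (tendsto_nat_mul_div_rpow h.one_lt _ _ (sub_nonneg.2 hst)) key
  exact sub_eq_zero.1 (norm_le_zero_iff.1 this)

theorem cauchySeq_partitionProduct (h : IsAlmostFlow I p δ η c L μ) {P : Finset ℝ → ℝ → ℝ → A}
    (hP : ∀ D, IsPartitionProduct I μ D (P D)) {s t : ℝ} (hs : s ∈ I) (ht : t ∈ I) (hst : s ≤ t)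
    (hd : t - s ≤ δ) : CauchySeq fun D => P D t s := by
  refine Metric.cauchySeq_iff'.2 fun ε hε => ?_
  set B := ‖(1 : A)‖ + 2 * η with hB
  have hB0 : 0 ≤ B := add_nonneg (norm_nonneg _) (by linarith [h.eta_nonneg])
  obtain ⟨N, hNε, hN⟩ := (((tendsto_nat_mul_div_rpow h.one_lt B (2 * L * B)
    (sub_nonneg.2 hst)).eventually_lt_const hε).and (eventually_gt_atTop 0)).exists
  refine ⟨uniformPartition s t N, fun D hD => ?_⟩
  set E := uniformPartition s t N
  rw [dist_comm, dist_eq_norm]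
  refine lt_of_le_of_lt ?_ hNε
  have := norm_sub_le_of_uniformPartition (Q := P D) (y := fun v => P E v s) (s := s) (t := t)
    (B := B) (b := 2 * L * B * ((t - s) / N) ^ p) hst hN hB0
    (fun u huE v hvE hsu huv hvt hvu => by
      have hu := h.ordConnected.out hs ht ⟨hsu, huv.trans hvt⟩
      have hv := h.ordConnected.out hs ht ⟨hsu.trans huv, hvt⟩
      refine ⟨(hP D).mul u hu t ht v (hD hvE) huv hvt,
        h.norm_le_of_norm_sub_le hv ht hvt (by linarith)
          (h.norm_partitionProduct_sub_le (hP D) hv ht hvt (by linarith)), ?_⟩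
      rw [← hvu, (hP E).mul s hs v hv u huE hsu huv, ← sub_mul]
      have h1 := h.norm_partitionProduct_sub_le (hP E) hu hv huv (by linarith)
      have h2 := h.norm_partitionProduct_sub_le (hP D) hu hv huv (by linarith)
      have h3 := norm_sub_le_norm_sub_add_norm_sub (P E v u) (μ v u) (P D v u)
      rw [norm_sub_rev (μ v u)] at h3
      have h4 : ‖P E u s‖ ≤ B := h.norm_le_of_norm_sub_le hs hu hsu (by linarith)
        (h.norm_partitionProduct_sub_le (hP E) hs hu hsu (by linarith))
      calc _ ≤ ‖P E v u - P D v u‖ * ‖P E u s‖ := norm_mul_le _ _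
        _ ≤ (L * (v - u) ^ p + L * (v - u) ^ p) * B :=
          mul_le_mul (by linarith) h4 (norm_nonneg _) (by linarith [norm_nonneg (P E v u - μ v u)])
        _ = _ := by ring)
  rwa [h.partitionProduct_self (hP D) ht, h.partitionProduct_self (hP E) hs, one_mul, mul_one]
    at this

/-- An almost flow is shadowed by a flow. -/
theorem exists_flow [CompleteSpace A] (h : IsAlmostFlow I p δ η c L μ) : ∃ M : ℝ → ℝ → A,
    (∀ s ∈ I, ∀ t ∈ I, ∀ u, s ≤ u → u ≤ t → M t s = M t u * M u s) ∧ (∀ s ∈ I, M s s = 1) ∧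
    ∀ s ∈ I, ∀ t ∈ I, s ≤ t → t - s ≤ δ → ‖M t s - μ t s‖ ≤ L * (t - s) ^ p := by
  choose P hP using exists_isPartitionProduct h.ordConnected h.self
  have conv : ∀ n : ℕ, ∀ s ∈ I, ∀ t ∈ I, s ≤ t → t - s ≤ n * δ →
      ∃ l, Tendsto (fun D => P D t s) atTop (𝓝 l) := by
    intro n
    induction n with
    | zero =>
      intro s hs t ht hst hd
      refine cauchySeq_tendsto_of_complete (h.cauchySeq_partitionProduct hP hs ht hst ?_)
      have := h.delta_pos
      simp only [Nat.cast_zero, zero_mul] at hd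
      linarith
    | succ n ih =>
      intro s hs t ht hst hd
      by_cases hd' : t - s ≤ δ
      · exact cauchySeq_tendsto_of_complete (h.cauchySeq_partitionProduct hP hs ht hst hd')
      have hδ := h.delta_pos
      have hu : t - δ ∈ I := h.ordConnected.out hs ht ⟨by linarith, by linarith⟩
      push_cast at hd
      obtain ⟨l, hl⟩ := ih s hs (t - δ) hu (by linarith) (by linarith)
      obtain ⟨l', hl'⟩ := cauchySeq_tendsto_of_complete
        (h.cauchySeq_partitionProduct hP hu ht (by linarith) (by linarith))
      refine ⟨l' * l, (hl'.mul hl).congr' ?_⟩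
      filter_upwards [eventually_ge_atTop {t - δ}] with D hD
      exact ((hP D).mul s hs t ht _ (Finset.singleton_subset_iff.1 hD) (by linarith)
        (by linarith)).symm
  have conv' : ∀ s t, ∃ l, s ∈ I → t ∈ I → s ≤ t → Tendsto (fun D => P D t s) atTop (𝓝 l) := by
    intro s t
    by_cases hst : s ∈ I ∧ t ∈ I ∧ s ≤ t
    · obtain ⟨n, hn⟩ := exists_nat_ge ((t - s) / δ)
      obtain ⟨l, hl⟩ := conv n s hst.1 t hst.2.1 hst.2.2 ((div_le_iff₀ h.delta_pos).1 hn)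
      exact ⟨l, fun _ _ _ => hl⟩
    · exact ⟨0, fun h1 h2 h3 => absurd ⟨h1, h2, h3⟩ hst⟩
  choose M hM using conv'
  refine ⟨fun t s => M s t, fun s hs t ht u hsu hut => ?_, fun s hs => ?_,
    fun s hs t ht hst hd => ?_⟩
  · have hu := h.ordConnected.out hs ht ⟨hsu, hut⟩
    refine tendsto_nhds_unique (hM s t hs ht (hsu.trans hut))
      (((hM u t hu ht hut).mul (hM s u hs hu hsu)).congr' ?_)
    filter_upwards [eventually_ge_atTop {u}] with D hD
    exact ((hP D).mul s hs t ht _ (Finset.singleton_subset_iff.1 hD) hsu hut).symm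
  · refine tendsto_nhds_unique (hM s s hs hs le_rfl) (tendsto_const_nhds.congr fun D => ?_)
    exact (h.partitionProduct_self (hP D) hs).symm
  · exact le_of_tendsto ((hM s t hs ht hst).sub_const _).norm
      (Eventually.of_forall fun D => h.norm_partitionProduct_sub_le (hP D) hs ht hst hd)

theorem eq_flow_mul (h : IsAlmostFlow I p δ η c L μ) {M : ℝ → ℝ → A}
    (hM : ∀ s ∈ I, ∀ t ∈ I, ∀ u, s ≤ u → u ≤ t → M t s = M t u * M u s) {g : ℝ → A}
    (hg : ∀ s ∈ I, ∀ t ∈ I, s ≤ t → t - s ≤ δ → g t = M t s * g s) {s t : ℝ} (hs : s ∈ I)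
    (ht : t ∈ I) (hst : s ≤ t) : g t = M t s * g s := by
  have hδ := h.delta_pos
  obtain ⟨n, hn⟩ := exists_nat_ge ((t - s) / δ)
  rw [div_le_iff₀ hδ] at hn
  induction n generalizing t with
  | zero =>
    rw [Nat.cast_zero, zero_mul] at hn
    exact hg s hs t ht hst (by linarith)
  | succ n ih =>
    by_cases hd : t - s ≤ δ
    · exact hg s hs t ht hst hd
    push_cast at hn
    have hu : t - δ ∈ I := h.ordConnected.out hs ht ⟨by linarith, by linarith⟩
    rw [hg (t - δ) hu t ht (by linarith) (by linarith), ih hu (by linarith) (by linarith),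
      ← mul_assoc, ← hM s hs t ht (t - δ) (by linarith) (by linarith)]

theorem exists_norm_flow_le (h : IsAlmostFlow I p δ η c L μ) {M : ℝ → ℝ → A}
    (hM : ∀ s ∈ I, ∀ t ∈ I, ∀ u, s ≤ u → u ≤ t → M t s = M t u * M u s)
    (hMμ : ∀ s ∈ I, ∀ t ∈ I, s ≤ t → t - s ≤ δ → ‖M t s - μ t s‖ ≤ L * (t - s) ^ p) (d : ℝ) :
    ∃ B, ∀ s ∈ I, ∀ t ∈ I, s ≤ t → t - s ≤ d → ‖M t s‖ ≤ B := by
  have hδ := h.delta_pos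
  have hloc : ∀ s ∈ I, ∀ t ∈ I, s ≤ t → t - s ≤ δ → ‖M t s‖ ≤ ‖(1 : A)‖ + 2 * η :=
    fun s hs t ht hst hd => h.norm_le_of_norm_sub_le hs ht hst hd (hMμ s hs t ht hst hd)
  obtain ⟨n, hn⟩ := exists_nat_ge (d / δ)
  rw [div_le_iff₀ hδ] at hn
  induction n generalizing d with
  | zero =>
    rw [Nat.cast_zero, zero_mul] at hn
    exact ⟨_, fun s hs t ht hst hd => hloc s hs t ht hst (by linarith)⟩
  | succ n ih =>
    push_cast at hn
    obtain ⟨B, hB⟩ := ih (d - δ) (by linarith)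
    refine ⟨max (‖(1 : A)‖ + 2 * η) ((‖(1 : A)‖ + 2 * η) * B), fun s hs t ht hst hd => ?_⟩
    by_cases hd' : t - s ≤ δ
    · exact (hloc s hs t ht hst hd').trans (le_max_left _ _)
    have hu : t - δ ∈ I := h.ordConnected.out hs ht ⟨by linarith, by linarith⟩
    refine le_trans ?_ (le_max_right _ _)
    rw [hM s hs t ht (t - δ) (by linarith) (by linarith)]
    exact (norm_mul_le _ _).trans (mul_le_mul (hloc _ hu t ht (by linarith) (by linarith))
      (hB s hs _ hu (by linarith) (by linarith)) (norm_nonneg _)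
      (add_nonneg (norm_nonneg _) (by linarith [h.eta_nonneg])))

end IsAlmostFlow

end NormedRing

section RoughDriver

variable {A : Type} [NormedRing A] {γ : ℝ} {T : EReal} {A1 A2 : ℝ → ℝ → A} {K : ℝ}

theorem rpow_two_mul_and_three_mul {x : ℝ} (hx : 0 ≤ x) (hγ : 0 ≤ γ) :
    x ^ (2 * γ) = x ^ γ * x ^ γ ∧ x ^ (3 * γ) = x ^ γ * x ^ γ * x ^ γ := by
  constructor
  · rw [← Real.rpow_add_of_nonneg hx hγ hγ]; congr 1; ring
  · rw [← Real.rpow_add_of_nonneg hx hγ hγ, ← Real.rpow_add_of_nonneg hx (by linarith) hγ]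
    congr 1; ring

theorem DriverNormBound.norm_le (hA : DriverNormBound γ T A1 A2 K) (hK : 0 ≤ K) (hγ : 0 ≤ γ)
    {s u v t : ℝ} (hs : 0 ≤ s) (hsu : s ≤ u) (huv : u ≤ v) (hvt : v ≤ t) (ht : (t : EReal) < T)
    (hd : t - s ≤ 1) :
    ‖A1 v u‖ ≤ K * (t - s) ^ γ ∧ ‖A2 v u‖ ≤ K * ((t - s) ^ γ * (t - s) ^ γ) := by
  obtain ⟨h1, h2⟩ := hA u v (hs.trans hsu) huv ((EReal.coe_le_coe_iff.2 hvt).trans_lt ht)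
    (by linarith)
  rw [← (rpow_two_mul_and_three_mul (x := t - s) (by linarith) hγ).1]
  refine ⟨h1.trans ?_, h2.trans ?_⟩
  · gcongr
  · gcongr

theorem exists_isAlmostFlow (hγ : 1 / 3 < γ) (hChen : ChenRelations T A1 A2)
    (hA : DriverNormBound γ T A1 A2 K) (hK : 0 ≤ K) : ∃ δ η c L : ℝ, δ ≤ 1 ∧
    IsAlmostFlow {t : ℝ | 0 ≤ t ∧ (t : EReal) < T} (3 * γ) δ η c L
      fun t s => 1 + (A1 t s + A2 t s) := by
  have hγ0 : 0 < γ := by linarith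
  have hcont : Tendsto (fun η : ℝ => 2 * (1 / 2 : ℝ) ^ (3 * γ) * (1 + 2 * η) ^ 2) (𝓝[>] 0)
      (𝓝 (2 * (1 / 2 : ℝ) ^ (3 * γ) * (1 + 2 * 0) ^ 2)) :=
    tendsto_nhdsWithin_of_tendsto_nhds (Continuous.tendsto (by fun_prop) 0)
  have hlt : 2 * (1 / 2 : ℝ) ^ (3 * γ) * (1 + 2 * 0) ^ 2 < 1 := by
    have := Real.rpow_lt_rpow_of_exponent_gt (x := 1 / 2) (by norm_num) (by norm_num)
      (show 1 < 3 * γ by linarith)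
    rw [Real.rpow_one] at this
    linarith
  obtain ⟨η, ⟨hη, hη1⟩, hη0⟩ := (((hcont.eventually_lt_const hlt).and
    (nhdsWithin_le_nhds (eventually_le_nhds one_pos))).and
    (eventually_mem_nhdsWithin (a := (0 : ℝ)) (s := Set.Ioi 0))).exists
  set θ := 2 * (1 / 2 : ℝ) ^ (3 * γ) * (1 + 2 * η) ^ 2
  have hη0' : 0 < η := hη0
  set c := 3 * K ^ 2 with hc
  set L := 3 * c / (1 - θ) with hLdef
  have hL0 : 0 ≤ L := div_nonneg (by positivity) (by linarith)
  have hL : L * (1 - θ) = 3 * c := div_mul_cancel₀ _ (by linarith)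
  have small : ∀ C q : ℝ, 0 < q → ∀ᶠ δ : ℝ in 𝓝[>] 0, C * δ ^ q < η := fun C q hq => by
    have : Tendsto (fun δ : ℝ => C * δ ^ q) (𝓝[>] 0) (𝓝 (C * 0 ^ q)) :=
      tendsto_nhdsWithin_of_tendsto_nhds
        ((Real.continuousAt_rpow_const 0 q (Or.inr hq.le)).const_mul C)
    rw [Real.zero_rpow hq.ne', mul_zero] at this
    exact this.eventually_lt_const hη0'
  obtain ⟨δ, ⟨⟨hδ1, hδ2⟩, hδle⟩, hδ0⟩ := ((((small (2 * K) γ hγ0).and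
    (small L (3 * γ) (by linarith))).and
    (nhdsWithin_le_nhds (eventually_le_nhds one_pos))).and
    (eventually_mem_nhdsWithin (a := (0 : ℝ)) (s := Set.Ioi 0))).exists
  refine ⟨δ, η, c, L, hδle, ?_, by linarith, hδ0, hη0'.le, hη1, by positivity, hL0, hδ2.le,
    by linarith, ?_, ?_, ?_⟩
  · refine ⟨fun x hx y hy z hz => ⟨hx.1.trans hz.1, ?_⟩⟩
    exact (EReal.coe_le_coe_iff.2 hz.2).trans_lt hy.2
  · intro s hs
    obtain ⟨h1, h2⟩ := hA s s hs.1 le_rfl hs.2 (by simp)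
    rw [sub_self, Real.zero_rpow (by linarith), mul_zero, norm_le_zero_iff] at h1 h2
    simp [h1, h2]
  · intro s hs t ht hst hd
    obtain ⟨h1, h2⟩ := hA.norm_le hK hγ0.le hs.1 le_rfl hst le_rfl ht.2 (by linarith)
    rw [add_sub_cancel_left]
    have hw0 : 0 ≤ (t - s) ^ γ := Real.rpow_nonneg (by linarith) _
    have hw1 : (t - s) ^ γ ≤ 1 := Real.rpow_le_one (by linarith) (by linarith) hγ0.le
    have hwδ : (t - s) ^ γ ≤ δ ^ γ := Real.rpow_le_rpow (by linarith) hd hγ0.le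
    have h3 : K * ((t - s) ^ γ * (t - s) ^ γ) ≤ K * (t - s) ^ γ :=
      mul_le_mul_of_nonneg_left (mul_le_of_le_one_right hw0 hw1) hK
    have h4 := mul_le_mul_of_nonneg_left hwδ hK
    have h5 := norm_add_le (A1 t s) (A2 t s)
    linarith
  · intro s hs t ht u hsu hut hd
    obtain ⟨h1, h2⟩ := hA.norm_le hK hγ0.le hs.1 le_rfl hsu hut ht.2 (by linarith)
    obtain ⟨h3, h4⟩ := hA.norm_le hK hγ0.le hs.1 hsu hut le_rfl ht.2 (by linarith)
    obtain ⟨e1, e2⟩ := hChen s u t hs.1 hsu hut ht.2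
    have hw0 : 0 ≤ (t - s) ^ γ := Real.rpow_nonneg (by linarith) _
    have hw1 : (t - s) ^ γ ≤ 1 := Real.rpow_le_one (by linarith) (by linarith) hγ0.le
    rw [(rpow_two_mul_and_three_mul (x := t - s) (by linarith) hγ0.le).2]
    have key : (1 + (A1 t u + A2 t u)) * (1 + (A1 u s + A2 u s)) - (1 + (A1 t s + A2 t s)) =
        A1 t u * A2 u s + A2 t u * A1 u s + A2 t u * A2 u s := by
      rw [e1, e2]; noncomm_ring
    rw [key]
    set w := (t - s) ^ γ
    have b1 : ‖A1 t u * A2 u s‖ ≤ K * w * (K * (w * w)) :=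
      (norm_mul_le _ _).trans (mul_le_mul h3 h2 (norm_nonneg _) (by positivity))
    have b2 : ‖A2 t u * A1 u s‖ ≤ K * (w * w) * (K * w) :=
      (norm_mul_le _ _).trans (mul_le_mul h4 h1 (norm_nonneg _) (by positivity))
    have b3 : ‖A2 t u * A2 u s‖ ≤ K * (w * w) * (K * (w * w)) :=
      (norm_mul_le _ _).trans (mul_le_mul h4 h2 (norm_nonneg _) (by positivity))
    have b4 : K * (w * w) * (K * (w * w)) ≤ K ^ 2 * (w * w * w) := by
      have : K * (w * w) * (K * (w * w)) = K ^ 2 * (w * w * w) * w := by ring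
      rw [this]
      exact mul_le_of_le_one_right (by positivity) hw1
    have b5 := norm_add₃_le (a := A1 t u * A2 u s) (b := A2 t u * A1 u s) (c := A2 t u * A2 u s)
    rw [hc]
    linarith

theorem IsRoughLinearSolution.eq_flow_mul {δ η c L : ℝ} (hδ : δ ≤ 1) (hγ : 0 ≤ γ)
    (h : IsAlmostFlow {t : ℝ | 0 ≤ t ∧ (t : EReal) < T} (3 * γ) δ η c L
      fun t s => 1 + (A1 t s + A2 t s)) {M : ℝ → ℝ → A}
    (hM : ∀ s : ℝ, (0 ≤ s ∧ (s : EReal) < T) → ∀ t : ℝ, (0 ≤ t ∧ (t : EReal) < T) →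
      ∀ u, s ≤ u → u ≤ t → M t s = M t u * M u s)
    (hM1 : ∀ s : ℝ, (0 ≤ s ∧ (s : EReal) < T) → M s s = 1)
    (hMμ : ∀ s : ℝ, (0 ≤ s ∧ (s : EReal) < T) → ∀ t : ℝ, (0 ≤ t ∧ (t : EReal) < T) → s ≤ t →
      t - s ≤ δ → ‖M t s - (1 + (A1 t s + A2 t s))‖ ≤ L * (t - s) ^ (3 * γ)) {g : ℝ → A}
    (hg : IsRoughLinearSolution γ T A1 A2 g) {s t : ℝ} (hs : 0 ≤ s) (hst : s ≤ t)
    (ht : (t : EReal) < T) : g t = M t s * g s := by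
  have hIs : ∀ {s t : ℝ}, s ≤ t → (t : EReal) < T → (s : EReal) < T := fun hst ht =>
    (EReal.coe_le_coe_iff.2 hst).trans_lt ht
  refine h.eq_flow_mul hM (g := g) ?_ ⟨hs, hIs hst ht⟩ ⟨hs.trans hst, ht⟩ hst
  rintro s hs t ht hst hd
  obtain ⟨C₁, hC₁⟩ := hg.1 t ht.2
  obtain ⟨C₂, hC₂⟩ := hg.2 t ht.2
  refine h.eq_mul_of_norm_sub_le hM hM1 hMμ (C := C₂ + L * (|C₁| + ‖g s‖)) hs ht hst hd
    fun u v hsu huv hvt => ?_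
  have hu : 0 ≤ u ∧ (u : EReal) < T := ⟨hs.1.trans hsu, hIs (huv.trans hvt) ht.2⟩
  have hv : 0 ≤ v ∧ (v : EReal) < T := ⟨hu.1.trans huv, hIs hvt ht.2⟩
  have hgu : ‖g u‖ ≤ |C₁| + ‖g s‖ := by
    have h1 := hC₁ s u hs.1 hsu (huv.trans hvt) (by linarith)
    have h2 : (u - s) ^ γ ≤ 1 := Real.rpow_le_one (by linarith) (by linarith) hγ
    have h3 : C₁ * (u - s) ^ γ ≤ |C₁| * 1 :=
      mul_le_mul (le_abs_self _) h2 (Real.rpow_nonneg (by linarith) _) (abs_nonneg _)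
    have h4 := norm_le_norm_add_norm_sub (g s) (g u)
    rw [norm_sub_rev] at h4
    have h5 := norm_sub_rev (g u) (g s)
    linarith
  have h1 := hC₂ u v hu.1 huv hvt (by linarith)
  have h2 := hMμ u hu v hv huv (by linarith)
  have h3 : ‖(M v u - (1 + (A1 v u + A2 v u))) * g u‖ ≤
      L * (v - u) ^ (3 * γ) * (|C₁| + ‖g s‖) :=
    (norm_mul_le _ _).trans (mul_le_mul h2 hgu (norm_nonneg _) ((norm_nonneg _).trans h2))
  have h4 : g v - M v u * g u = (g v - g u - (A1 v u + A2 v u) * g u) -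
      (M v u - (1 + (A1 v u + A2 v u))) * g u := by noncomm_ring
  rw [h4]
  have h5 := norm_sub_le (g v - g u - (A1 v u + A2 v u) * g u)
    ((M v u - (1 + (A1 v u + A2 v u))) * g u)
  linarith

theorem isRoughLinearSolution_flow_mul {δ η c L : ℝ} (hγ : 0 ≤ γ)
    (hA : DriverNormBound γ T A1 A2 K) (hK : 0 ≤ K)
    (h : IsAlmostFlow {t : ℝ | 0 ≤ t ∧ (t : EReal) < T} (3 * γ) δ η c L
      fun t s => 1 + (A1 t s + A2 t s)) {M : ℝ → ℝ → A}
    (hM : ∀ s : ℝ, (0 ≤ s ∧ (s : EReal) < T) → ∀ t : ℝ, (0 ≤ t ∧ (t : EReal) < T) →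
      ∀ u, s ≤ u → u ≤ t → M t s = M t u * M u s)
    (hMμ : ∀ s : ℝ, (0 ≤ s ∧ (s : EReal) < T) → ∀ t : ℝ, (0 ≤ t ∧ (t : EReal) < T) → s ≤ t →
      t - s ≤ δ → ‖M t s - (1 + (A1 t s + A2 t s))‖ ≤ L * (t - s) ^ (3 * γ)) (f₀ : A) :
    IsRoughLinearSolution γ T A1 A2 fun t => M t 0 * f₀ := by
  have hIs : ∀ {s t : ℝ}, s ≤ t → (t : EReal) < T → (s : EReal) < T := fun hst ht =>
    (EReal.coe_le_coe_iff.2 hst).trans_lt ht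
  have hδ0 := h.delta_pos
  have hL := h.L_nonneg
  set f : ℝ → A := fun t => M t 0 * f₀ with hf
  have hbound : ∀ S : ℝ, (S : EReal) < T → ∃ B, 0 ≤ B ∧ ∀ t, 0 ≤ t → t ≤ S → ‖f t‖ ≤ B := by
    intro S hS
    obtain ⟨B, hB⟩ := h.exists_norm_flow_le hM hMμ S
    refine ⟨|B| * ‖f₀‖, by positivity, fun t ht htS => ?_⟩
    refine (norm_mul_le _ _).trans ?_
    gcongr
    have htT := hIs htS hS
    exact (hB 0 ⟨le_rfl, hIs ht htT⟩ t ⟨ht, htT⟩ ht (by linarith)).trans (le_abs_self B)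
  have hdriver : ∀ s t : ℝ, 0 ≤ s → s ≤ t → (t : EReal) < T → t - s ≤ 1 →
      ‖A1 t s + A2 t s‖ ≤ 2 * K * (t - s) ^ γ := fun s t hs hst ht hd => by
    obtain ⟨h1, h2⟩ := hA.norm_le hK hγ hs le_rfl hst le_rfl ht hd
    have hw1 : (t - s) ^ γ ≤ 1 := Real.rpow_le_one (by linarith) hd hγ
    have h3 : K * ((t - s) ^ γ * (t - s) ^ γ) ≤ K * (t - s) ^ γ :=
      mul_le_mul_of_nonneg_left
        (mul_le_of_le_one_right (Real.rpow_nonneg (by linarith) _) hw1) hK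
    have h5 := norm_add_le (A1 t s) (A2 t s)
    linarith
  have hrem : LocallyHolder (3 * γ) T fun t s => f t - f s - (A1 t s + A2 t s) * f s := by
    intro S hS
    obtain ⟨B, hB0, hB⟩ := hbound S hS
    refine ⟨L * B + (2 * B + 2 * K * B) / δ ^ (3 * γ), fun s t hs hst htS hd => ?_⟩
    have htT := hIs htS hS
    have hsT := hIs hst htT
    have hfs := hB s hs (hst.trans htS)
    have hW : 0 ≤ (t - s) ^ (3 * γ) := Real.rpow_nonneg (by linarith) _
    have hδp : 0 < δ ^ (3 * γ) := Real.rpow_pos_of_pos hδ0 _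
    have hBK : 0 ≤ 2 * B + 2 * K * B := by positivity
    rw [add_mul]
    by_cases hd' : t - s ≤ δ
    · have e : f t - f s - (A1 t s + A2 t s) * f s =
          (M t s - (1 + (A1 t s + A2 t s))) * f s := by
        have : f t = M t s * f s := by
          simp only [hf]
          rw [hM 0 ⟨le_rfl, hIs hs hsT⟩ t ⟨hs.trans hst, htT⟩ s hs hst, mul_assoc]
        rw [this]; noncomm_ring
      simp only [e]
      have h1 := hMμ s ⟨hs, hsT⟩ t ⟨hs.trans hst, htT⟩ hst hd'
      have h2 : ‖(M t s - (1 + (A1 t s + A2 t s))) * f s‖ ≤ L * (t - s) ^ (3 * γ) * B :=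
        (norm_mul_le _ _).trans (mul_le_mul h1 hfs (norm_nonneg _) (by positivity))
      have h3 : 0 ≤ (2 * B + 2 * K * B) / δ ^ (3 * γ) * (t - s) ^ (3 * γ) := by positivity
      linarith
    · have h1 : ‖A1 t s + A2 t s‖ ≤ 2 * K := (hdriver s t hs hst htT hd).trans
        (mul_le_of_le_one_right (by positivity) (Real.rpow_le_one (by linarith) hd hγ))
      have h2 : ‖(A1 t s + A2 t s) * f s‖ ≤ 2 * K * B :=
        (norm_mul_le _ _).trans (mul_le_mul h1 hfs (norm_nonneg _) (by positivity))
      have h3 : δ ^ (3 * γ) ≤ (t - s) ^ (3 * γ) :=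
        Real.rpow_le_rpow hδ0.le (by linarith) (by linarith)
      have h4 : 2 * B + 2 * K * B ≤ (2 * B + 2 * K * B) / δ ^ (3 * γ) * (t - s) ^ (3 * γ) := by
        rw [div_mul_eq_mul_div, le_div_iff₀ hδp]
        gcongr
      have h5 := norm_sub_le (f t - f s) ((A1 t s + A2 t s) * f s)
      have h6 := norm_sub_le (f t) (f s)
      have h7 := hB t (hs.trans hst) htS
      have h8 : 0 ≤ L * B * (t - s) ^ (3 * γ) := by positivity
      linarith
  refine ⟨fun S hS => ?_, hrem⟩
  obtain ⟨B, hB0, hB⟩ := hbound S hS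
  obtain ⟨C, hC⟩ := hrem S hS
  refine ⟨|C| + 2 * K * B, fun s t hs hst htS hd => ?_⟩
  have h1 := hC s t hs hst htS hd
  have h2 : (t - s) ^ (3 * γ) ≤ (t - s) ^ γ :=
    Real.rpow_le_rpow_of_exponent_ge' (by linarith) hd hγ (by linarith)
  have h3 : C * (t - s) ^ (3 * γ) ≤ |C| * (t - s) ^ γ :=
    mul_le_mul (le_abs_self _) h2 (Real.rpow_nonneg (by linarith) _) (abs_nonneg _)
  have h4 : ‖(A1 t s + A2 t s) * f s‖ ≤ 2 * K * (t - s) ^ γ * B :=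
    (norm_mul_le _ _).trans (mul_le_mul (hdriver s t hs hst (hIs htS hS) hd)
      (hB s hs (hst.trans htS)) (norm_nonneg _)
      (mul_nonneg (by positivity) (Real.rpow_nonneg (by linarith) _)))
  have h5 := norm_add_le (f t - f s - (A1 t s + A2 t s) * f s) ((A1 t s + A2 t s) * f s)
  rw [sub_add_cancel] at h5
  linarith

end RoughDriver

theorem exists_unique_solution_bounded_rough_driver
    (γ : ℝ) (hγ1 : 1 / 3 < γ) (hγ2 : γ ≤ 1 / 2)
    (A : Type) [NormedRing A] [NormedAlgebra ℝ A] [CompleteSpace A]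
    (T : EReal) (hT : 0 < T)
    (A1 A2 : ℝ → ℝ → A)
    (hChen : ChenRelations T A1 A2)
    (hNorm : ∃ K : ℝ, DriverNormBound γ T A1 A2 K)
    (f₀ : A) :
    ∃ f : ℝ → A, f 0 = f₀ ∧ IsRoughLinearSolution γ T A1 A2 f ∧
      ∀ g : ℝ → A, g 0 = f₀ → IsRoughLinearSolution γ T A1 A2 g →
        ∀ t : ℝ, 0 ≤ t → (t : EReal) < T → g t = f t := by
  obtain ⟨K, hK⟩ := hNorm
  have hA : DriverNormBound γ T A1 A2 |K| := fun s t hs hst ht hd => by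
    have hd0 : 0 ≤ t - s := sub_nonneg.2 hst
    obtain ⟨h1, h2⟩ := hK s t hs hst ht hd
    exact ⟨h1.trans (by gcongr; exact le_abs_self K), h2.trans (by gcongr; exact le_abs_self K)⟩
  have hγ : 0 ≤ γ := by linarith
  obtain ⟨δ, η, c, L, hδ, h⟩ := exists_isAlmostFlow hγ1 hChen hA (abs_nonneg K)
  obtain ⟨M, hM, hM1, hMμ⟩ := h.exists_flow
  refine ⟨fun t => M t 0 * f₀, ?_,
    isRoughLinearSolution_flow_mul hγ hA (abs_nonneg K) h hM hMμ f₀, fun g hg0 hg t ht htT => ?_⟩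
  · simp [hM1 0 ⟨le_rfl, hT⟩]
  · rw [← hg0]
    exact hg.eq_flow_mul hδ hγ h hM hM1 hMμ le_rfl ht htT
end

section
/- Let 1/3 < γ ≤ 1/2, let 𝒜 be a Banach algebra with unit, T ∈ (0,∞], and let 𝐀 = (A¹,A²) be a bounded γ-rough driver in 𝒜 on [0,T). Let f₀ ∈ 𝒜 and let f : [0,T) → 𝒜 be a path with f(0) = f₀, γ-Hölder on bounded intervals, such that f♯_{ts} := f_t − f_s − (A¹_{ts}+A²_{ts}) f_s is locally 3γ-Hölder. Then there exists λ₀ > 0, depending only on γ and ‖𝐀‖, such that sup_{0 ≤ t < T} e^{−t/λ₀} |f_t| ≤ 2 |f₀|; in particular |f_t| ≤ 2 e^{t/λ₀} |f₀| for all t. -/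
/-- A nonempty closed upper set of nonnegative reals that is stable under an affine contraction
contains the fixed point of that contraction. -/
lemma mem_of_isClosed_of_mapsTo_affine {S : Set ℝ} (hS : IsClosed S) (hne : S.Nonempty)
    (hbdd : BddBelow S) (hup : IsUpperSet S) {θ D : ℝ} (hθ : θ < 1)
    (hmaps : Set.MapsTo (fun C => θ * C + D) S S) : D / (1 - θ) ∈ S := by
  have hmem := hS.csInf_mem hne hbdd
  have hle : sInf S ≤ θ * sInf S + D := csInf_le hbdd (hmaps hmem)
  refine hup ?_ hmem
  rw [le_div_iff₀ (by linarith)]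
  linarith

/-- The remainder `f♯` of a controlled path with respect to the driver `(A1, A2)`. -/
def roughRemainder {A : Type} [NormedRing A] (A1 A2 : ℝ → ℝ → A) (f : ℝ → A) (t s : ℝ) : A :=
  f t - f s - (A1 t s + A2 t s) * f s

section

variable {A : Type} [NormedRing A] {γ K : ℝ} {T : EReal} {A1 A2 : ℝ → ℝ → A} {f : ℝ → A}

lemma ChenRelations.roughRemainder_eq (h : ChenRelations T A1 A2) {s u t : ℝ} (hs : 0 ≤ s)
    (hsu : s ≤ u) (hut : u ≤ t) (ht : (t : EReal) < T) :
    roughRemainder A1 A2 f t s = roughRemainder A1 A2 f t u + roughRemainder A1 A2 f u s +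
      (A1 t u * (roughRemainder A1 A2 f u s + A2 u s * f s) + A2 t u * (f u - f s)) := by
  obtain ⟨h1, h2⟩ := h s u t hs hsu hut ht
  simp only [roughRemainder, h1, h2]
  noncomm_ring

lemma DriverNormBound.mono {K' : ℝ} (h : DriverNormBound γ T A1 A2 K) (hK : K ≤ K') :
    DriverNormBound γ T A1 A2 K' := by
  intro s t hs hst ht hd
  obtain ⟨h1, h2⟩ := h s t hs hst ht hd
  have hd0 : 0 ≤ t - s := sub_nonneg.2 hst
  exact ⟨h1.trans (by gcongr), h2.trans (by gcongr)⟩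

lemma rpow_two_mul_eq {d : ℝ} (hd : 0 ≤ d) : d ^ (2 * γ) = (d ^ γ) ^ 2 := by
  rw [mul_comm, Real.rpow_mul hd]; norm_cast

lemma rpow_three_mul_eq {d : ℝ} (hd : 0 ≤ d) : d ^ (3 * γ) = (d ^ γ) ^ 3 := by
  rw [mul_comm, Real.rpow_mul hd]; norm_cast

lemma DriverNormBound.norm_sub_le (hA : DriverNormBound γ T A1 A2 K) {s t : ℝ} (hs : 0 ≤ s)
    (hst : s ≤ t) (ht : (t : EReal) < T) (hd : t - s ≤ 1) :
    ‖f t - f s‖ ≤ ‖roughRemainder A1 A2 f t s‖ +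
      K * ((t - s) ^ γ + ((t - s) ^ γ) ^ 2) * ‖f s‖ := by
  obtain ⟨h1, h2⟩ := hA s t hs hst ht hd
  rw [rpow_two_mul_eq (sub_nonneg.2 hst)] at h2
  have hsplit : f t - f s = roughRemainder A1 A2 f t s + (A1 t s + A2 t s) * f s := by
    simp [roughRemainder]
  rw [hsplit]
  calc _ ≤ ‖roughRemainder A1 A2 f t s‖ + (‖A1 t s‖ + ‖A2 t s‖) * ‖f s‖ :=
        (norm_add_le _ _).trans <| add_le_add_right
          ((norm_mul_le _ _).trans (by gcongr; exact norm_add_le _ _)) _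
    _ ≤ _ := by
        gcongr
        linarith

/-- One step of the sewing argument: a bound on the remainder at the midpoint scale yields an
improved bound on the full scale. -/
lemma norm_roughRemainder_le_of_bound (hγ : 0 < γ) (hK : 0 ≤ K) (hC : ChenRelations T A1 A2)
    (hA : DriverNormBound γ T A1 A2 K) {a b x M N : ℝ} (ha : 0 ≤ a) (hb : (b : EReal) < T)
    (hab : b - a ≤ 1) (hx : (b - a) ^ γ ≤ x) (hx1 : x ≤ 1)
    (hM : ∀ t, a ≤ t → t ≤ b → ‖f t‖ ≤ M) (hN0 : 0 ≤ N)
    (hN : ∀ s t, a ≤ s → s ≤ t → t ≤ b →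
      ‖roughRemainder A1 A2 f t s‖ ≤ N * (t - s) ^ (3 * γ))
    {s t : ℝ} (hs : a ≤ s) (hst : s ≤ t) (ht : t ≤ b) :
    ‖roughRemainder A1 A2 f t s‖ ≤
      ((2 ^ (1 - 3 * γ) + 2 * K * x) * N + 3 * K ^ 2 * M) * (t - s) ^ (3 * γ) := by
  set u := (s + t) / 2 with hu
  have hsu : s ≤ u := by linarith
  have hut : u ≤ t := by linarith
  have htT : (t : EReal) < T := lt_of_le_of_lt (by exact_mod_cast ht) hb
  have huT : (u : EReal) < T := lt_of_le_of_lt (by exact_mod_cast hut) htT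
  have hd : 0 ≤ t - s := sub_nonneg.2 hst
  have hM0 : 0 ≤ M := (norm_nonneg _).trans (hM s hs (hst.trans ht))
  have hhalf : 2 * ((t - s) / 2) ^ (3 * γ) = 2 ^ (1 - 3 * γ) * (t - s) ^ (3 * γ) := by
    rw [Real.div_rpow hd zero_le_two, Real.rpow_sub zero_lt_two, Real.rpow_one]
    ring
  set e := (t - s) ^ γ with he
  have he0 : 0 ≤ e := Real.rpow_nonneg hd _
  have hex : e ≤ x := (Real.rpow_le_rpow hd (by linarith) hγ.le).trans hx
  have hx0 : 0 ≤ x := he0.trans hex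
  have hdt : t - u = (t - s) / 2 := by rw [hu]; ring
  have hds : u - s = (t - s) / 2 := by rw [hu]; ring
  have hue : (t - u) ^ γ ≤ e := Real.rpow_le_rpow (by linarith) (by linarith) hγ.le
  have hse : (u - s) ^ γ ≤ e := Real.rpow_le_rpow (by linarith) (by linarith) hγ.le
  have hue0 : 0 ≤ (t - u) ^ γ := Real.rpow_nonneg (by linarith) _
  have hse0 : 0 ≤ (u - s) ^ γ := Real.rpow_nonneg (by linarith) _
  have hRtu := hN u t (hs.trans hsu) hut ht
  have hRus := hN s u hs hsu (hut.trans ht)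
  have hRus' : ‖roughRemainder A1 A2 f u s‖ ≤ N * e ^ 3 := by
    rw [rpow_three_mul_eq (by linarith)] at hRus
    exact hRus.trans (by gcongr)
  obtain ⟨hA1, hA2⟩ := hA u t (by linarith) hut htT (by linarith)
  obtain ⟨-, hB2⟩ := hA s u (by linarith) hsu huT (by linarith)
  rw [rpow_two_mul_eq (by linarith)] at hA2 hB2
  have hA1' : ‖A1 t u‖ ≤ K * e := hA1.trans (by gcongr)
  have hA2' : ‖A2 t u‖ ≤ K * e ^ 2 := hA2.trans (by gcongr)
  have hB2' : ‖A2 u s‖ ≤ K * e ^ 2 := hB2.trans (by gcongr)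
  have hfs : ‖f s‖ ≤ M := hM s hs (hst.trans ht)
  have hf : ‖f u - f s‖ ≤ N * e ^ 3 + K * (e + e ^ 2) * M :=
    (hA.norm_sub_le (by linarith) hsu huT (by linarith)).trans (by gcongr)
  have hdefect : ‖A1 t u * (roughRemainder A1 A2 f u s + A2 u s * f s) + A2 t u * (f u - f s)‖ ≤
      K * e * (N * e ^ 3 + K * e ^ 2 * M) + K * e ^ 2 * (N * e ^ 3 + K * (e + e ^ 2) * M) := by
    refine (norm_add_le _ _).trans (add_le_add ?_ ?_)
    · refine (norm_mul_le _ _).trans ?_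
      gcongr
      refine (norm_add_le _ _).trans (add_le_add hRus' ((norm_mul_le _ _).trans ?_))
      gcongr
    · refine (norm_mul_le _ _).trans ?_
      gcongr
  have hpoly : K * e * (N * e ^ 3 + K * e ^ 2 * M) + K * e ^ 2 * (N * e ^ 3 + K * (e + e ^ 2) * M)
      ≤ (2 * K * x * N + 3 * K ^ 2 * M) * e ^ 3 := by
    have hex2 : e ^ 2 ≤ x := by nlinarith
    have he1 : e ≤ 1 := hex.trans hx1
    calc _ = (K * (e + e ^ 2) * N + K ^ 2 * (2 + e) * M) * e ^ 3 := by ring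
      _ ≤ (K * (x + x) * N + K ^ 2 * (2 + 1) * M) * e ^ 3 := by gcongr
      _ = _ := by ring
  have he3 : (t - s) ^ (3 * γ) = e ^ 3 := rpow_three_mul_eq hd
  rw [hC.roughRemainder_eq (by linarith) hsu hut htT]
  rw [hdt] at hRtu
  rw [hds] at hRus
  calc _ ≤ ‖roughRemainder A1 A2 f t u‖ + ‖roughRemainder A1 A2 f u s‖ + _ := norm_add₃_le
    _ ≤ N * ((t - s) / 2) ^ (3 * γ) + N * ((t - s) / 2) ^ (3 * γ) +
        (2 * K * x * N + 3 * K ^ 2 * M) * e ^ 3 := by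
        gcongr
        exact hdefect.trans hpoly
    _ = N * (2 * ((t - s) / 2) ^ (3 * γ)) + (2 * K * x * N + 3 * K ^ 2 * M) * e ^ 3 := by ring
    _ = _ := by rw [hhalf, he3]; ring

/-- On a short interval the remainder is controlled by the supremum of the path. -/
lemma norm_roughRemainder_le (hγ : 0 < γ) (hK : 0 ≤ K) (hC : ChenRelations T A1 A2)
    (hA : DriverNormBound γ T A1 A2 K) (hf : IsRoughLinearSolution γ T A1 A2 f)
    {a b x M : ℝ} (ha : 0 ≤ a) (hle : a ≤ b) (hb : (b : EReal) < T)
    (hab : b - a ≤ 1) (hx : (b - a) ^ γ ≤ x) (hx1 : x ≤ 1)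
    (hθ : 2 ^ (1 - 3 * γ) + 2 * K * x < 1)
    (hM : ∀ t, a ≤ t → t ≤ b → ‖f t‖ ≤ M) {s t : ℝ} (hs : a ≤ s) (hst : s ≤ t) (ht : t ≤ b) :
    ‖roughRemainder A1 A2 f t s‖ ≤
      3 * K ^ 2 * M / (1 - (2 ^ (1 - 3 * γ) + 2 * K * x)) * (t - s) ^ (3 * γ) := by
  let S : Set ℝ := {N | 0 ≤ N ∧ ∀ s t, a ≤ s → s ≤ t → t ≤ b →
    ‖roughRemainder A1 A2 f t s‖ ≤ N * (t - s) ^ (3 * γ)}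
  have hM0 : 0 ≤ M := (norm_nonneg _).trans (hM a le_rfl hle)
  have hx0 : 0 ≤ x := (Real.rpow_nonneg (sub_nonneg.2 hle) _).trans hx
  suffices h : 3 * K ^ 2 * M / (1 - (2 ^ (1 - 3 * γ) + 2 * K * x)) ∈ S from h.2 s t hs hst ht
  refine mem_of_isClosed_of_mapsTo_affine ?_ ?_ ⟨0, fun _ h => h.1⟩ ?_ hθ ?_
  · simp only [S, Set.ofPred_and, Set.ofPred_forall]
    refine isClosed_Ici.inter ?_
    repeat refine isClosed_iInter fun _ => ?_
    exact isClosed_le continuous_const (by fun_prop)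
  · obtain ⟨C, hC'⟩ := hf.2 b hb
    refine ⟨max C 0, le_max_right _ _, fun s t hs hst ht => ?_⟩
    refine (hC' s t (ha.trans hs) hst ht (by linarith)).trans ?_
    have : 0 ≤ t - s := sub_nonneg.2 hst
    gcongr
    exact le_max_left _ _
  · intro N N' hNN' hN
    refine ⟨hN.1.trans hNN', fun s t hs hst ht => (hN.2 s t hs hst ht).trans ?_⟩
    have : 0 ≤ t - s := sub_nonneg.2 hst
    gcongr
  · intro N hN
    refine ⟨?_, fun s t hs hst ht =>
      norm_roughRemainder_le_of_bound hγ hK hC hA ha hb hab hx hx1 hM hN.1 hN.2 hs hst ht⟩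
    have := hN.1
    positivity

/-- On a short interval a solution at most doubles in norm. -/
lemma norm_le_two_mul_of_short (hγ : 0 < γ) (hK : 0 ≤ K) (hC : ChenRelations T A1 A2)
    (hA : DriverNormBound γ T A1 A2 K) (hf : IsRoughLinearSolution γ T A1 A2 f)
    {a b x : ℝ} (ha : 0 ≤ a) (hle : a ≤ b) (hb : (b : EReal) < T)
    (hab : b - a ≤ 1) (hx : (b - a) ^ γ ≤ x) (hx1 : x ≤ 1)
    (hθ : 2 ^ (1 - 3 * γ) + 2 * K * x < 1)
    (hsmall : 3 * K ^ 2 / (1 - (2 ^ (1 - 3 * γ) + 2 * K * x)) * x ^ 3 + K * (x + x ^ 2) ≤ 1 / 2) :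
    ‖f b‖ ≤ 2 * ‖f a‖ := by
  let S : Set ℝ := {M | ∀ t, a ≤ t → t ≤ b → ‖f t‖ ≤ M}
  suffices h : ‖f a‖ / (1 - 1 / 2) ∈ S by
    have := h b hle le_rfl
    norm_num at this
    linarith
  refine mem_of_isClosed_of_mapsTo_affine ?_ ?_ ⟨‖f a‖, fun M (hM : M ∈ S) => hM a le_rfl hle⟩ ?_
    (by norm_num) ?_
  · simp only [S, Set.ofPred_forall]
    repeat refine isClosed_iInter fun _ => ?_
    exact isClosed_le continuous_const continuous_id
  · obtain ⟨C, hC'⟩ := hf.1 b hb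
    refine ⟨‖f a‖ + |C|, fun t hat htb => ?_⟩
    have hd : 0 ≤ t - a := sub_nonneg.2 hat
    have h1 : C * (t - a) ^ γ ≤ |C| * 1 :=
      mul_le_mul (le_abs_self C) (Real.rpow_le_one hd (by linarith) hγ.le)
        (Real.rpow_nonneg hd _) (abs_nonneg C)
    have h2 := hC' a t ha hat htb (by linarith)
    have h3 := norm_le_norm_add_norm_sub (f a) (f t)
    linarith [norm_sub_rev (f a) (f t)]
  · exact fun M M' hMM' hM t hat htb => (hM t hat htb).trans hMM'
  · intro M hM t hat htb
    have hd : 0 ≤ t - a := sub_nonneg.2 hat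
    have hM0 : 0 ≤ M := (norm_nonneg _).trans (hM a le_rfl hle)
    have he0 : 0 ≤ (t - a) ^ γ := Real.rpow_nonneg hd _
    have hex : (t - a) ^ γ ≤ x := (Real.rpow_le_rpow hd (by linarith) hγ.le).trans hx
    have htT : (t : EReal) < T := lt_of_le_of_lt (by exact_mod_cast htb) hb
    have h1 := norm_roughRemainder_le hγ hK hC hA hf ha hle hb hab hx hx1 hθ hM le_rfl hat htb
    have h2 := hA.norm_sub_le (f := f) ha hat htT (by linarith)
    have h3 := norm_le_norm_add_norm_sub (f a) (f t)
    have hθ' := sub_pos.2 hθ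
    have hx0 : 0 ≤ x := he0.trans hex
    rw [rpow_three_mul_eq hd] at h1
    have h4 : ‖f t - f a‖ ≤ 1 / 2 * M := by
      calc _ ≤ _ := h2
        _ ≤ 3 * K ^ 2 * M / (1 - (2 ^ (1 - 3 * γ) + 2 * K * x)) * x ^ 3 +
            K * (x + x ^ 2) * M := by
          gcongr
          · exact h1.trans (by gcongr)
          · exact hM a le_rfl hle
        _ = (3 * K ^ 2 / (1 - (2 ^ (1 - 3 * γ) + 2 * K * x)) * x ^ 3 + K * (x + x ^ 2)) * M := by
          ring
        _ ≤ _ := by gcongr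
    linarith [norm_sub_rev (f a) (f t)]

end

/-- A function that at most doubles over every time step of length `h` grows at most
exponentially. -/
lemma norm_le_two_mul_exp_of_doubling {E : Type*} [NormedAddCommGroup E] {T : EReal} {f : ℝ → E}
    {h : ℝ} (hh : 0 < h)
    (hf : ∀ a b : ℝ, 0 ≤ a → a ≤ b → b - a ≤ h → (b : EReal) < T → ‖f b‖ ≤ 2 * ‖f a‖)
    {t : ℝ} (ht : 0 ≤ t) (htT : (t : EReal) < T) :
    ‖f t‖ ≤ 2 * Real.exp (t / (h / Real.log 2)) * ‖f 0‖ := by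
  have key : ∀ n : ℕ, ∀ t : ℝ, 0 ≤ t → t ≤ (n + 1) * h → (t : EReal) < T →
      ‖f t‖ ≤ 2 ^ (n + 1) * ‖f 0‖ := by
    intro n
    induction n with
    | zero =>
      intro t ht htn htT
      simpa using hf 0 t le_rfl ht (by simpa using htn) htT
    | succ n ih =>
      intro t ht htn htT
      push_cast at htn
      have hlast := hf (max 0 (t - h)) t (le_max_left _ _) (max_le ht (by linarith))
        (by linarith [le_max_right 0 (t - h)]) htT
      have hprev := ih (max 0 (t - h)) (le_max_left _ _) (max_le (by positivity) (by linarith))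
        (lt_of_le_of_lt (by exact_mod_cast max_le ht (by linarith)) htT)
      rw [pow_succ]
      linarith
  have hn := key ⌊t / h⌋₊ t ht ((div_le_iff₀ hh).1 (Nat.lt_floor_add_one _).le) htT
  refine hn.trans ?_
  gcongr
  rw [pow_succ, mul_comm]
  gcongr
  calc (2 : ℝ) ^ ⌊t / h⌋₊ = Real.exp (Real.log 2 * ⌊t / h⌋₊) := by
        rw [← Real.rpow_natCast, Real.rpow_def_of_pos zero_lt_two]
    _ ≤ Real.exp (Real.log 2 * (t / h)) := by
        have : 0 ≤ Real.log 2 := Real.log_nonneg one_le_two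
        gcongr
        exact Nat.floor_le (by positivity)
    _ = _ := by
        congr 1
        field_simp

/-- Choice of the scale below which the contraction estimates hold. -/
lemma exists_contraction_scale {K θ : ℝ} (hK : 1 ≤ K) (hθ0 : 0 ≤ θ) (hθ : θ < 1) :
    ∃ x, 0 < x ∧ x ≤ 1 ∧ θ + 2 * K * x < 1 ∧
      3 * K ^ 2 / (1 - (θ + 2 * K * x)) * x ^ 3 + K * (x + x ^ 2) ≤ 1 / 2 := by
  have hK0 : 0 < K := by linarith
  have hθ' : 0 < 1 - θ := by linarith
  set x := (1 - θ) / (24 * K ^ 2) with hx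
  have hx0 : 0 < x := by positivity
  have hKx : K ^ 2 * x = (1 - θ) / 24 := by rw [hx]; field_simp
  have hKx' : K * x ≤ (1 - θ) / 24 := by nlinarith
  have hx1 : x ≤ 1 := by nlinarith
  have hden : (1 - θ) / 2 ≤ 1 - (θ + 2 * K * x) := by linarith
  refine ⟨x, hx0, hx1, by linarith, ?_⟩
  have h1 : 3 * K ^ 2 / (1 - (θ + 2 * K * x)) * x ^ 3 ≤ 1 / 4 := by
    rw [div_mul_eq_mul_div, div_le_iff₀ (by linarith)]
    calc 3 * K ^ 2 * x ^ 3 = 3 * (K ^ 2 * x) * x ^ 2 := by ring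
      _ ≤ 3 * (K ^ 2 * x) * 1 := by gcongr; exact pow_le_one₀ hx0.le hx1
      _ ≤ _ := by linarith
  have h2 : K * x ^ 2 ≤ K * x := by
    gcongr
    nlinarith
  linarith

theorem apriori_estimate_bounded_rough_driver
    (γ : ℝ) (hγ1 : 1 / 3 < γ) (hγ2 : γ ≤ 1 / 2) (K : ℝ) :
    ∃ lam₀ : ℝ, 0 < lam₀ ∧
      ∀ (A : Type) [NormedRing A] [NormedAlgebra ℝ A] [CompleteSpace A]
        (T : EReal), 0 < T →
      ∀ (A1 A2 : ℝ → ℝ → A), ChenRelations T A1 A2 →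
        DriverNormBound γ T A1 A2 K →
      ∀ (f₀ : A) (f : ℝ → A), f 0 = f₀ →
        IsRoughLinearSolution γ T A1 A2 f →
        ∀ t : ℝ, 0 ≤ t → (t : EReal) < T →
          Real.exp (-(t / lam₀)) * ‖f t‖ ≤ 2 * ‖f₀‖ ∧
          ‖f t‖ ≤ 2 * Real.exp (t / lam₀) * ‖f₀‖ := by
  have hγ : 0 < γ := by linarith
  have hK : 1 ≤ max K 1 := le_max_right _ _
  have hθ : (2 : ℝ) ^ (1 - 3 * γ) < 1 :=
    Real.rpow_lt_one_of_one_lt_of_neg one_lt_two (by linarith)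
  obtain ⟨x, hx0, hx1, hcontr, hsmall⟩ := exists_contraction_scale hK (by positivity) hθ
  set h := x ^ γ⁻¹ with hh
  have hh0 : 0 < h := Real.rpow_pos_of_pos hx0 _
  have hh1 : h ≤ 1 := Real.rpow_le_one hx0.le hx1 (by positivity)
  have hhx : h ^ γ = x := Real.rpow_inv_rpow hx0.le hγ.ne'
  refine ⟨h / Real.log 2, div_pos hh0 (Real.log_pos one_lt_two), ?_⟩
  intro A _ _ _ T _ A1 A2 hC hA f₀ f hf0 hf t ht htT
  have hbound := norm_le_two_mul_exp_of_doubling hh0 (f := f) (T := T)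
    (fun a b ha hab hbh hb => norm_le_two_mul_of_short hγ (by linarith) hC
      (hA.mono (le_max_left K 1)) hf ha hab hb (hbh.trans hh1)
      ((Real.rpow_le_rpow (sub_nonneg.2 hab) hbh hγ.le).trans hhx.le) hx1 hcontr hsmall) ht htT
  rw [hf0] at hbound
  refine ⟨?_, hbound⟩
  rw [Real.exp_neg, inv_mul_le_iff₀ (Real.exp_pos _)]
  linarith
end
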